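/- (Non-commutative Khintchine inequality for 0<q<1, Schatten-class version.) For every 0<q<1 there is a constant β_q, depending only on q, such that for every n ≥ 1, every N ≥ 1 and all matrices x_1,…,x_N ∈ M_n(ℂ) one has |||x|||_q ≤ β_q (E_ε ‖∑_{k=1}^N ε_k x_k‖_q^q)^{1/q}. -/

import Mathlib

open scoped BigOperators
open Matrix MeasureTheory
open scoped ComplexOrder

/-- `A^β` for a Hermitian (in practice positive semidefinite) matrix `A`, via the
spectral functional calculus (with the conventions of `Real.rpow` on eigenvalues,
in particular `0 ^ β = 0` for `β ≠ 0`), extended by `0` to non-Hermitian matrices. -/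
noncomputable def posPow {ι : Type*} [Fintype ι] [DecidableEq ι]
    (A : Matrix ι ι ℂ) (β : ℝ) : Matrix ι ι ℂ :=
  if hA : A.IsHermitian then hA.cfc (fun t => t ^ β) else 0

/-- Schatten `p`-(quasi)norm of a complex matrix: `(Tr((A*A)^(p/2)))^(1/p)`. -/
noncomputable def schattenNorm {ι : Type*} [Fintype ι] [DecidableEq ι]
    (p : ℝ) (A : Matrix ι ι ℂ) : ℝ :=
  ((posPow (Aᴴ * A) (p / 2)).trace.re) ^ (1 / p)

/-- Operator norm of a matrix, acting on the Euclidean space. -/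
noncomputable def opNorm {ι : Type*} [Fintype ι] [DecidableEq ι]
    (A : Matrix ι ι ℂ) : ℝ :=
  ‖Matrix.toEuclideanCLM (𝕜 := ℂ) A‖

/-- The quantity `|||x|||_p` for `0 < p ≤ 2`: the infimum of
`‖(∑ aₖ*aₖ)^(1/2)‖_p + ‖(∑ bₖbₖ*)^(1/2)‖_p` over decompositions `xₖ = aₖ + bₖ`. -/
noncomputable def tripleNorm {n N : ℕ} (p : ℝ)
    (x : Fin N → Matrix (Fin n) (Fin n) ℂ) : ℝ :=
  sInf { r : ℝ | ∃ a b : Fin N → Matrix (Fin n) (Fin n) ℂ,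
    (∀ k, x k = a k + b k) ∧
    r = schattenNorm p (posPow (∑ k, (a k)ᴴ * a k) (1/2))
        + schattenNorm p (posPow (∑ k, b k * (b k)ᴴ) (1/2)) }

/-- `E_ε ‖∑ ε_k x_k‖_p ^ p`, the average over a uniformly random choice of signs. -/
noncomputable def radAvg {n N : ℕ} (p : ℝ)
    (x : Fin N → Matrix (Fin n) (Fin n) ℂ) : ℝ :=
  (1 / 2 ^ N) * ∑ ε : Fin N → Bool,
    (schattenNorm p (∑ k, (if ε k then (1 : ℂ) else -1) • x k)) ^ p


section SpectralSum

variable {ι : Type*} [DecidableEq ι]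

/-- The diagonal complex matrix with prescribed real entries. -/
noncomputable def rdiag (d : ι → ℝ) : Matrix ι ι ℂ := diagonal fun i => (d i : ℂ)

lemma rdiag_conjTranspose (d : ι → ℝ) : (rdiag d)ᴴ = rdiag d := by
  simp [rdiag, diagonal_conjTranspose, Pi.star_def]

lemma rdiag_one : rdiag (fun _ : ι => (1 : ℝ)) = 1 := by
  simp [rdiag]

variable [Fintype ι]

lemma rdiag_mul (d e : ι → ℝ) : rdiag d * rdiag e = rdiag fun i => d i * e i := by
  simp [rdiag, diagonal_mul_diagonal]

/-- The sum of `φ` over the (real parts of the) eigenvalues of `A`, with multiplicity. -/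
noncomputable def specSum (φ : ℝ → ℝ) (A : Matrix ι ι ℂ) : ℝ :=
  (A.charpoly.roots.map fun z => φ z.re).sum

lemma specSum_mul_comm (φ : ℝ → ℝ) (A B : Matrix ι ι ℂ) :
    specSum φ (A * B) = specSum φ (B * A) := by
  rw [specSum, charpoly_mul_comm, specSum]

lemma specSum_conj (φ : ℝ → ℝ) {U : Matrix ι ι ℂ} (hU : Uᴴ * U = 1) (A : Matrix ι ι ℂ) :
    specSum φ (U * A * Uᴴ) = specSum φ A := by
  rw [specSum_mul_comm, ← Matrix.mul_assoc, hU, Matrix.one_mul]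

lemma specSum_rdiag (φ : ℝ → ℝ) (d : ι → ℝ) : specSum φ (rdiag d) = ∑ i, φ (d i) := by
  rw [specSum, rdiag, charpoly_diagonal, Polynomial.roots_prod _ _
    (Finset.prod_ne_zero_iff.mpr fun i _ => Polynomial.X_sub_C_ne_zero _)]
  simp

lemma specSum_conj_rdiag (φ : ℝ → ℝ) {U : Matrix ι ι ℂ} (hU : Uᴴ * U = 1) (d : ι → ℝ) :
    specSum φ (U * rdiag d * Uᴴ) = ∑ i, φ (d i) := by
  rw [specSum_conj φ hU, specSum_rdiag]

lemma exists_eq_conj_rdiag {A : Matrix ι ι ℂ} (hA : A.IsHermitian) :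
    ∃ (U : Matrix ι ι ℂ) (d : ι → ℝ), Uᴴ * U = 1 ∧ U * Uᴴ = 1 ∧ A = U * rdiag d * Uᴴ :=
  ⟨hA.eigenvectorUnitary, hA.eigenvalues,
    Unitary.coe_star_mul_self _, Unitary.coe_mul_star_self _, by
      conv_lhs => rw [hA.spectral_theorem, Unitary.conjStarAlgAut_apply]
      rfl⟩

lemma conj_conj_rdiag {U A : Matrix ι ι ℂ} {d : ι → ℝ} (hU : Uᴴ * U = 1)
    (h : A = U * rdiag d * Uᴴ) : Uᴴ * A * U = rdiag d := by
  rw [h]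
  calc Uᴴ * (U * rdiag d * Uᴴ) * U = (Uᴴ * U) * rdiag d * (Uᴴ * U) := by
        simp only [Matrix.mul_assoc]
    _ = _ := by simp [hU]

lemma nonneg_of_posSemidef_conj {U A : Matrix ι ι ℂ} {d : ι → ℝ} (hU : Uᴴ * U = 1)
    (h : A = U * rdiag d * Uᴴ) (hA : A.PosSemidef) (i : ι) : 0 ≤ d i := by
  have h1 : (rdiag d).PosSemidef := by
    rw [← conj_conj_rdiag hU h]; exact hA.conjTranspose_mul_mul_same U
  have := posSemidef_diagonal_iff.mp h1 i
  simpa using this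

lemma pos_of_posDef_conj {U A : Matrix ι ι ℂ} {d : ι → ℝ} (hU : Uᴴ * U = 1)
    (h : A = U * rdiag d * Uᴴ) (hA : A.PosDef) (i : ι) : 0 < d i := by
  have h1 : (rdiag d).PosDef := by
    rw [← conj_conj_rdiag hU h]
    refine hA.conjTranspose_mul_mul_same ?_
    intro x y hxy
    have := congrArg (Uᴴ *ᵥ ·) hxy
    simpa [Matrix.mulVec_mulVec, hU] using this
  have := posDef_diagonal_iff.mp h1 i
  simpa using this

lemma posSemidef_conj_rdiag (U : Matrix ι ι ℂ) {d : ι → ℝ} (hd : ∀ i, 0 ≤ d i) :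
    (U * rdiag d * Uᴴ).PosSemidef :=
  PosSemidef.mul_mul_conjTranspose_same
    (posSemidef_diagonal_iff.mpr fun i => by simpa using hd i) U

lemma conj_rdiag_mul {U : Matrix ι ι ℂ} (hU : Uᴴ * U = 1) (d e : ι → ℝ) :
    (U * rdiag d * Uᴴ) * (U * rdiag e * Uᴴ) = U * rdiag (fun i => d i * e i) * Uᴴ := by
  calc (U * rdiag d * Uᴴ) * (U * rdiag e * Uᴴ)
      = U * rdiag d * (Uᴴ * U) * rdiag e * Uᴴ := by simp only [Matrix.mul_assoc]
    _ = _ := by rw [hU, Matrix.mul_one, Matrix.mul_assoc U, rdiag_mul]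

lemma conj_rdiag_conjTranspose (U : Matrix ι ι ℂ) (d : ι → ℝ) :
    (U * rdiag d * Uᴴ)ᴴ = U * rdiag d * Uᴴ := by
  simp [Matrix.conjTranspose_mul, rdiag_conjTranspose, Matrix.mul_assoc]

lemma trace_conj_rdiag {U : Matrix ι ι ℂ} (hU : Uᴴ * U = 1) (d : ι → ℝ) :
    (U * rdiag d * Uᴴ).trace = ∑ i, (d i : ℂ) := by
  rw [Matrix.trace_mul_comm, ← Matrix.mul_assoc, hU, Matrix.one_mul, rdiag, trace_diagonal]

lemma specSum_id {A : Matrix ι ι ℂ} (hA : A.IsHermitian) :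
    specSum (fun t => t) A = A.trace.re := by
  obtain ⟨U, d, hU, -, rfl⟩ := exists_eq_conj_rdiag hA
  rw [specSum_conj_rdiag _ hU, trace_conj_rdiag hU]; simp

lemma specSum_mono {φ ψ : ℝ → ℝ} {A : Matrix ι ι ℂ} (hA : A.PosSemidef)
    (h : ∀ t, 0 ≤ t → φ t ≤ ψ t) : specSum φ A ≤ specSum ψ A := by
  obtain ⟨U, d, hU, -, hd⟩ := exists_eq_conj_rdiag hA.1
  have h0 := nonneg_of_posSemidef_conj hU hd hA
  rw [hd, specSum_conj_rdiag _ hU, specSum_conj_rdiag _ hU]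
  exact Finset.sum_le_sum fun i _ => h _ (h0 i)

lemma specSum_add {φ ψ : ℝ → ℝ} (A : Matrix ι ι ℂ) :
    specSum (fun t => φ t + ψ t) A = specSum φ A + specSum ψ A := by
  simp [specSum, Multiset.sum_map_add]

lemma specSum_const_mul {φ : ℝ → ℝ} (c : ℝ) (A : Matrix ι ι ℂ) :
    specSum (fun t => c * φ t) A = c * specSum φ A := by
  simp [specSum, Multiset.sum_map_mul_left]

lemma specSum_nonneg {φ : ℝ → ℝ} {A : Matrix ι ι ℂ} (hA : A.PosSemidef)
    (h : ∀ t, 0 ≤ t → 0 ≤ φ t) : 0 ≤ specSum φ A := by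
  obtain ⟨U, d, hU, -, hd⟩ := exists_eq_conj_rdiag hA.1
  have h0 := nonneg_of_posSemidef_conj hU hd hA
  rw [hd, specSum_conj_rdiag _ hU]
  exact Finset.sum_nonneg fun i _ => h _ (h0 i)

lemma trace_rdiag_mul_mul_rdiag_mul (W : Matrix ι ι ℂ) (d e : ι → ℝ) :
    (rdiag d * W * rdiag e * Wᴴ).trace.re =
      ∑ i, ∑ j, d i * e j * Complex.normSq (W i j) := by
  simp only [Matrix.trace, Matrix.diag_apply, Matrix.mul_apply (N := Wᴴ), rdiag,
    Matrix.mul_diagonal, Matrix.diagonal_mul, Matrix.conjTranspose_apply, Complex.re_sum]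
  refine Finset.sum_congr rfl fun i _ => Finset.sum_congr rfl fun j _ => ?_
  have : (d i : ℂ) * W i j * e j * star (W i j)
      = ((d i * e j * Complex.normSq (W i j) : ℝ) : ℂ) := by
    push_cast
    rw [Complex.normSq_eq_conj_mul_self]; simp; ring
  rw [this, Complex.ofReal_re]

lemma trace_conj_rdiag_mul (U V : Matrix ι ι ℂ) (d e : ι → ℝ) :
    ((U * rdiag d * Uᴴ) * (V * rdiag e * Vᴴ)).trace.re =
      ∑ i, ∑ j, d i * e j * Complex.normSq ((Uᴴ * V) i j) := by
  rw [← trace_rdiag_mul_mul_rdiag_mul, Matrix.conjTranspose_mul, Matrix.conjTranspose_conjTranspose]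
  rw [Matrix.mul_assoc U, Matrix.mul_assoc U, Matrix.trace_mul_comm]
  simp only [Matrix.mul_assoc]

lemma sum_normSq_row {W : Matrix ι ι ℂ} (hW : W * Wᴴ = 1) (i : ι) :
    ∑ j, Complex.normSq (W i j) = 1 := by
  have h := congrFun (congrFun hW i) i
  rw [Matrix.mul_apply, Matrix.one_apply_eq] at h
  have h2 := congrArg Complex.re h
  simp only [Complex.re_sum, Complex.one_re, Matrix.conjTranspose_apply] at h2
  rw [← h2]
  refine Finset.sum_congr rfl fun j _ => ?_
  simp [Complex.normSq_apply]

lemma sum_normSq_col {W : Matrix ι ι ℂ} (hW : Wᴴ * W = 1) (j : ι) :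
    ∑ i, Complex.normSq (W i j) = 1 := by
  have := sum_normSq_row (W := Wᴴ) (by simpa using hW) j
  simpa [Matrix.conjTranspose_apply] using this

/-- Klein-type comparison: a scalar inequality `ψ a ≤ g₀ b + g₁ b * a`, required for those pairs
of eigenvalues whose eigenvectors are not orthogonal, passes to traces. -/
lemma specSum_le_of_pointwise {U V : Matrix ι ι ℂ} {d g₀ g₁ : ι → ℝ} {ψ : ℝ → ℝ}
    (hU : Uᴴ * U = 1) (hU' : U * Uᴴ = 1) (hV : Vᴴ * V = 1) (hV' : V * Vᴴ = 1)
    (h : ∀ i j, (Uᴴ * V) i j ≠ 0 → ψ (d i) ≤ g₀ j + g₁ j * d i) :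
    specSum ψ (U * rdiag d * Uᴴ) ≤
      ∑ j, g₀ j + ((U * rdiag d * Uᴴ) * (V * rdiag g₁ * Vᴴ)).trace.re := by
  have hW : (Uᴴ * V) * (Uᴴ * V)ᴴ = 1 := by
    rw [Matrix.conjTranspose_mul, Matrix.conjTranspose_conjTranspose, Matrix.mul_assoc,
      ← Matrix.mul_assoc V, hV', Matrix.one_mul, hU]
  have hW' : (Uᴴ * V)ᴴ * (Uᴴ * V) = 1 := by
    rw [Matrix.conjTranspose_mul, Matrix.conjTranspose_conjTranspose, Matrix.mul_assoc,
      ← Matrix.mul_assoc U, hU', Matrix.one_mul, hV]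
  rw [specSum_conj_rdiag _ hU, trace_conj_rdiag_mul]
  calc ∑ i, ψ (d i) = ∑ i, ∑ j, ψ (d i) * Complex.normSq ((Uᴴ * V) i j) := by
        refine Finset.sum_congr rfl fun i _ => ?_
        rw [← Finset.mul_sum, sum_normSq_row hW, mul_one]
    _ ≤ ∑ i, ∑ j, (g₀ j + g₁ j * d i) * Complex.normSq ((Uᴴ * V) i j) := by
        refine Finset.sum_le_sum fun i _ => Finset.sum_le_sum fun j _ => ?_
        by_cases hc : (Uᴴ * V) i j = 0
        · simp [hc]
        · exact mul_le_mul_of_nonneg_right (h i j hc) (Complex.normSq_nonneg _)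
    _ = ∑ j, g₀ j + ∑ i, ∑ j, d i * g₁ j * Complex.normSq ((Uᴴ * V) i j) := by
        simp only [add_mul, Finset.sum_add_distrib]
        congr 1
        · rw [Finset.sum_comm]
          refine Finset.sum_congr rfl fun j _ => ?_
          rw [← Finset.mul_sum, sum_normSq_col hW', mul_one]
        · refine Finset.sum_congr rfl fun i _ => Finset.sum_congr rfl fun j _ => by ring

lemma young_rpow {s a b : ℝ} (hs0 : 0 < s) (hs1 : s < 1) (ha : 0 ≤ a) (hb : 0 < b) :
    a ^ s ≤ b ^ s + b ^ (s - 1) * a := by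
  rcases le_total a b with h | h
  · have h1 := Real.rpow_le_rpow ha h hs0.le
    have : 0 ≤ b ^ (s - 1) * a := by positivity
    linarith
  · have ha' : 0 < a := hb.trans_le h
    have h1 : a ^ (s - 1) ≤ b ^ (s - 1) := Real.rpow_le_rpow_of_nonpos hb h (by linarith)
    have h2 : a ^ s = a ^ (s - 1) * a := by
      rw [Real.rpow_sub_one ha'.ne']; field_simp
    have h3 : 0 ≤ b ^ s := by positivity
    have := mul_le_mul_of_nonneg_right h1 ha
    linarith

/-- `Tr X^s ≤ Tr G^s + Tr (X G^(s-1))` for `X ≥ 0`, `G > 0`. -/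
lemma specSum_rpow_le {s : ℝ} (hs0 : 0 < s) (hs1 : s < 1) {X V : Matrix ι ι ℂ} {g : ι → ℝ}
    (hX : X.PosSemidef) (hV : Vᴴ * V = 1) (hV' : V * Vᴴ = 1) (hg : ∀ i, 0 < g i) :
    specSum (· ^ s) X ≤
      ∑ j, g j ^ s + (X * (V * rdiag (fun j => g j ^ (s - 1)) * Vᴴ)).trace.re := by
  obtain ⟨U, d, hU, hU', hd⟩ := exists_eq_conj_rdiag hX.1
  have h0 := nonneg_of_posSemidef_conj hU hd hX
  rw [hd]
  exact specSum_le_of_pointwise hU hU' hV hV' fun i j _ => young_rpow hs0 hs1 (h0 i) (hg j)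

lemma re_trace_mul_nonneg {A B : Matrix ι ι ℂ} (hA : A.PosSemidef) (hB : B.PosSemidef) :
    0 ≤ (A * B).trace.re := by
  obtain ⟨U, d, hU, -, hd⟩ := exists_eq_conj_rdiag hA.1
  obtain ⟨V, e, hV, -, he⟩ := exists_eq_conj_rdiag hB.1
  have h0 := nonneg_of_posSemidef_conj hU hd hA
  have h1 := nonneg_of_posSemidef_conj hV he hB
  rw [hd, he, trace_conj_rdiag_mul]
  exact Finset.sum_nonneg fun i _ => Finset.sum_nonneg fun j _ =>
    mul_nonneg (mul_nonneg (h0 i) (h1 j)) (Complex.normSq_nonneg _)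

lemma re_trace_mul_le_of_sub {A B C : Matrix ι ι ℂ} (hC : C.PosSemidef)
    (h : (B - A).PosSemidef) : (C * A).trace.re ≤ (C * B).trace.re := by
  have := re_trace_mul_nonneg hC h
  rw [Matrix.mul_sub, Matrix.trace_sub, Complex.sub_re] at this
  linarith

/-- Monotonicity of `A ↦ Tr ψ(A)` on positive matrices, for `ψ` with nonnegative supergradients
on `(0, ∞)`. -/
lemma specSum_le_of_le {ψ g : ℝ → ℝ}
    (hg : ∀ b, 0 ≤ g b) (h : ∀ a b, 0 ≤ a → 0 < b → ψ a ≤ ψ b + g b * (a - b))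
    {A B : Matrix ι ι ℂ} (hA : A.PosSemidef) (hB : B.PosSemidef) (hAB : (B - A).PosSemidef) :
    specSum ψ A ≤ specSum ψ B := by
  obtain ⟨U, d, hU, hU', hd⟩ := exists_eq_conj_rdiag hA.1
  obtain ⟨V, e, hV, hV', he⟩ := exists_eq_conj_rdiag hB.1
  have h0 := nonneg_of_posSemidef_conj hU hd hA
  have h1 := nonneg_of_posSemidef_conj hV he hB
  have key : ∀ i j, (Uᴴ * V) i j ≠ 0 → ψ (d i) ≤ (ψ (e j) - g (e j) * e j) + g (e j) * d i := by
    intro i j hij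
    rcases (h1 j).eq_or_lt with hj | hj
    · -- `A ≤ B` forces `d i = 0` here
      have hdi : d i = 0 := by
        have hp := (hAB.conjTranspose_mul_mul_same V).diag_nonneg (i := j)
        rw [Matrix.mul_sub, Matrix.sub_mul, conj_conj_rdiag hV he, hd] at hp
        have h2 : (Vᴴ * (U * rdiag d * Uᴴ) * V) j j
            = ((∑ k, d k * Complex.normSq ((Uᴴ * V) k j) : ℝ) : ℂ) := by
          have : Vᴴ * (U * rdiag d * Uᴴ) * V = (Uᴴ * V)ᴴ * (rdiag d * (Uᴴ * V)) := by
            simp [Matrix.conjTranspose_mul, Matrix.mul_assoc]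
          rw [this, Matrix.mul_apply]
          push_cast
          refine Finset.sum_congr rfl fun k _ => ?_
          rw [rdiag, Matrix.diagonal_mul, Matrix.conjTranspose_apply,
            Complex.normSq_eq_conj_mul_self]
          simp; ring
        rw [Matrix.sub_apply, h2, rdiag, diagonal_apply_eq, ← hj, ← Complex.ofReal_sub] at hp
        have hp' : (∑ k, d k * Complex.normSq ((Uᴴ * V) k j)) ≤ 0 := by
          have := Complex.zero_le_real.mp hp; linarith
        have hz := (Finset.sum_eq_zero_iff_of_nonneg (fun k _ =>
          mul_nonneg (h0 k) (Complex.normSq_nonneg _))).mp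
          (le_antisymm hp' (Finset.sum_nonneg fun k _ =>
            mul_nonneg (h0 k) (Complex.normSq_nonneg _))) i (Finset.mem_univ i)
        exact (mul_eq_zero.mp hz).resolve_right (by simpa [Complex.normSq_eq_zero] using hij)
      simp [hdi, ← hj]
    · have := h (d i) (e j) (h0 i) hj
      linarith
  have h2 := specSum_le_of_pointwise hU hU' hV hV' key
  rw [← hd] at h2
  have hGps : (V * rdiag (fun j => g (e j)) * Vᴴ).PosSemidef :=
    posSemidef_conj_rdiag V fun j => hg _
  have h3 := re_trace_mul_le_of_sub hGps hAB
  rw [Matrix.trace_mul_comm] at h3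
  have h4 : ((V * rdiag (fun j => g (e j)) * Vᴴ) * B).trace.re = ∑ j, g (e j) * e j := by
    rw [he, conj_rdiag_mul hV, trace_conj_rdiag hV]; simp
  have h5 : specSum ψ B = ∑ j, ψ (e j) := by rw [he, specSum_conj_rdiag _ hV]
  rw [Finset.sum_sub_distrib] at h2
  linarith

end SpectralSum

section TraceInequalities

variable {ι : Type*} [Fintype ι] [DecidableEq ι]

lemma conj_conj_rdiag_apply (U W : Matrix ι ι ℂ) (d : ι → ℝ) (i : ι) :
    (Uᴴ * (W * rdiag d * Wᴴ) * U) i i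
      = ((∑ l, d l * Complex.normSq ((Uᴴ * W) i l) : ℝ) : ℂ) := by
  have : Uᴴ * (W * rdiag d * Wᴴ) * U = (Uᴴ * W * rdiag d) * (Uᴴ * W)ᴴ := by
    simp [Matrix.conjTranspose_mul, Matrix.mul_assoc]
  rw [this, Matrix.mul_apply]
  push_cast
  refine Finset.sum_congr rfl fun k _ => ?_
  rw [rdiag, Matrix.mul_diagonal, Matrix.conjTranspose_apply, Complex.normSq_eq_conj_mul_self]
  simp; ring

/-- If `0 ≤ A ≤ C` then `Tr (A C^(s-1)) ≤ Tr A^s`, where `C^(s-1)` vanishes on `ker C`. -/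
lemma trace_mul_rpow_sub_one_le {s : ℝ} (hs0 : 0 < s) (hs1 : s < 1) {A W : Matrix ι ι ℂ}
    {c : ι → ℝ} (hA : A.PosSemidef) (hW : Wᴴ * W = 1) (hW' : W * Wᴴ = 1) (hc : ∀ i, 0 ≤ c i)
    (hAC : (W * rdiag c * Wᴴ - A).PosSemidef) :
    (A * (W * rdiag (fun l => c l ^ (s - 1)) * Wᴴ)).trace.re ≤ specSum (· ^ s) A := by
  obtain ⟨U, a, hU, hU', ha⟩ := exists_eq_conj_rdiag hA.1
  have h0 := nonneg_of_posSemidef_conj hU ha hA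
  have hQ : (Uᴴ * W) * (Uᴴ * W)ᴴ = 1 := by
    rw [Matrix.conjTranspose_mul, Matrix.conjTranspose_conjTranspose, Matrix.mul_assoc,
      ← Matrix.mul_assoc W, hW', Matrix.one_mul, hU]
  rw [ha, trace_conj_rdiag_mul, specSum_conj_rdiag _ hU]
  refine Finset.sum_le_sum fun i _ => ?_
  set q : ι → ℝ := fun l => Complex.normSq ((Uᴴ * W) i l) with hq
  have hq0 : ∀ l, 0 ≤ q l := fun l => Complex.normSq_nonneg _
  have hq1 : ∑ l, q l = 1 := sum_normSq_row hQ i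
  set T : ℝ := ∑ l, (c l)⁻¹ * q l with hT
  have hT0 : 0 ≤ T := Finset.sum_nonneg fun l _ => mul_nonneg (inv_nonneg.mpr (hc l)) (hq0 l)
  have hTa : a i * T ≤ 1 := by
    set P := W * rdiag (fun l => (c l)⁻¹) * Wᴴ with hP
    have hPh : Pᴴ = P := conj_rdiag_conjTranspose W _
    have h1 := ((hAC.conjTranspose_mul_mul_same P).conjTranspose_mul_mul_same U).diag_nonneg
      (i := i)
    have h2 : Pᴴ * (W * rdiag c * Wᴴ - A) * P = P - P * A * P := by
      rw [hPh, Matrix.mul_sub, Matrix.sub_mul, hP, conj_rdiag_mul hW, conj_rdiag_mul hW]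
      congr 4
      funext l
      by_cases hl : c l = 0
      · simp [hl]
      · field_simp
    have h3 : (Uᴴ * P * U) i i = ((T : ℝ) : ℂ) := by rw [hP, conj_conj_rdiag_apply]
    have h4 : (Uᴴ * (P * A * P) * U) i i
        = ((∑ l, a l * Complex.normSq ((Uᴴ * P * U) i l) : ℝ) : ℂ) := by
      have e : Uᴴ * (P * A * P) * U = ((Pᴴ * U)ᴴ) * (U * rdiag a * Uᴴ) * (Pᴴ * U) := by
        rw [← ha, Matrix.conjTranspose_mul, Matrix.conjTranspose_conjTranspose]
        simp only [Matrix.mul_assoc, hPh]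
      rw [e, conj_conj_rdiag_apply, Matrix.conjTranspose_mul, Matrix.conjTranspose_conjTranspose]
    rw [h2, Matrix.mul_sub, Matrix.sub_mul, Matrix.sub_apply, h3, h4, ← Complex.ofReal_sub] at h1
    have h5 := Complex.zero_le_real.mp h1
    have h6 : a i * (T * T) ≤ ∑ l, a l * Complex.normSq ((Uᴴ * P * U) i l) := by
      have := Finset.single_le_sum (f := fun l => a l * Complex.normSq ((Uᴴ * P * U) i l))
        (fun l _ => mul_nonneg (h0 l) (Complex.normSq_nonneg _)) (Finset.mem_univ i)
      simpa [h3, Complex.normSq_ofReal] using this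
    rcases hT0.eq_or_lt with hz | hz
    · rw [← hz]; simp
    · by_contra hcon
      push Not at hcon
      nlinarith
  have hJ : ∑ l, q l * ((c l)⁻¹) ^ (1 - s) ≤ T ^ (1 - s) := by
    have := (Real.concaveOn_rpow (p := 1 - s) (by linarith) (by linarith)).le_map_sum
      (t := Finset.univ) (w := q) (p := fun l => (c l)⁻¹) (fun l _ => hq0 l) hq1
      (fun l _ => inv_nonneg.mpr (hc l))
    simp only [smul_eq_mul] at this
    refine this.trans_eq ?_
    rw [hT]
    congr 1
    exact Finset.sum_congr rfl fun l _ => mul_comm _ _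
  have hrw : ∀ l, (c l) ^ (s - 1) = ((c l)⁻¹) ^ (1 - s) := fun l => by
    rw [Real.inv_rpow (hc l), ← Real.rpow_neg (hc l)]; congr 1; ring
  have hsum : ∑ l, a i * c l ^ (s - 1) * Complex.normSq ((Uᴴ * W) i l)
      = a i * ∑ l, q l * ((c l)⁻¹) ^ (1 - s) := by
    rw [Finset.mul_sum]
    refine Finset.sum_congr rfl fun l _ => ?_
    rw [hrw]; ring
  rw [hsum]
  rcases (h0 i).eq_or_lt with hz | hz
  · rw [← hz]; simp [Real.zero_rpow hs0.ne']
  · calc a i * ∑ l, q l * ((c l)⁻¹) ^ (1 - s) ≤ a i * T ^ (1 - s) := by gcongr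
      _ ≤ a i * ((a i)⁻¹) ^ (1 - s) := by
          have : T ≤ (a i)⁻¹ := by
            rw [← one_div, le_div_iff₀ hz]; linarith
          gcongr
      _ = a i ^ s := by
          rw [Real.inv_rpow hz.le, ← Real.rpow_neg hz.le]
          nth_rewrite 1 [← Real.rpow_one (a i)]
          rw [← Real.rpow_add hz]; congr 1; ring

lemma specSum_rpow_add_le {s : ℝ} (hs0 : 0 < s) (hs1 : s < 1) {A B : Matrix ι ι ℂ}
    (hA : A.PosSemidef) (hB : B.PosSemidef) :
    specSum (· ^ s) (A + B) ≤ specSum (· ^ s) A + specSum (· ^ s) B := by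
  obtain ⟨W, c, hW, hW', hc⟩ := exists_eq_conj_rdiag (hA.add hB).1
  have h0 := nonneg_of_posSemidef_conj hW hc (hA.add hB)
  have h1 := trace_mul_rpow_sub_one_le hs0 hs1 hA hW hW' h0 (by rw [← hc]; simpa using hB)
  have h2 := trace_mul_rpow_sub_one_le hs0 hs1 hB hW hW' h0 (by rw [← hc]; simpa using hA)
  have h3 : ((A + B) * (W * rdiag (fun l => c l ^ (s - 1)) * Wᴴ)).trace.re
      = specSum (· ^ s) (A + B) := by
    rw [hc, conj_rdiag_mul hW, trace_conj_rdiag hW, specSum_conj_rdiag _ hW, Complex.re_sum]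
    refine Finset.sum_congr rfl fun l _ => ?_
    rcases (h0 l).eq_or_lt with hz | hz
    · rw [← hz]; simp [Real.zero_rpow hs0.ne']
    · rw [Complex.ofReal_re, Real.rpow_sub_one hz.ne']; field_simp
  rw [← h3, Matrix.add_mul, Matrix.trace_add, Complex.add_re]
  exact add_le_add h1 h2

lemma specSum_rpow_le_of_le {s : ℝ} (hs0 : 0 < s) (hs1 : s < 1) {A B : Matrix ι ι ℂ}
    (hA : A.PosSemidef) (hB : B.PosSemidef) (hAB : (B - A).PosSemidef) :
    specSum (· ^ s) A ≤ specSum (· ^ s) B := by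
  refine specSum_le_of_le (g := fun b => if 0 ≤ b then s * b ^ (s - 1) else 0)
    (fun b => ?_) (fun a b ha hb => ?_) hA hB hAB
  · split_ifs with h
    · positivity
    · exact le_rfl
  · rw [if_pos hb.le]
    have h1 := rpow_one_add_le_one_add_mul_self (s := a / b - 1) (p := s)
      (by have : 0 ≤ a / b := by positivity
          linarith) hs0.le hs1.le
    have e1 : a ^ s = b ^ s * (1 + (a / b - 1)) ^ s := by
      rw [← Real.mul_rpow hb.le (by simp; positivity)]
      congr 1; field_simp; ring
    have e2 : b ^ s + s * b ^ (s - 1) * (a - b) = b ^ s * (1 + s * (a / b - 1)) := by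
      rw [Real.rpow_sub_one hb.ne']; field_simp
    rw [e1, e2]
    gcongr

lemma specSum_min_sqrt_le_of_le {τ : ℝ} {A B : Matrix ι ι ℂ}
    (hA : A.PosSemidef) (hB : B.PosSemidef) (hAB : (B - A).PosSemidef) :
    specSum (fun t => min (√t) τ) A ≤ specSum (fun t => min (√t) τ) B := by
  refine specSum_le_of_le (g := fun b => if √b ≤ τ then 1 / (2 * √b) else 0)
    (fun b => ?_) (fun a b ha hb => ?_) hA hB hAB
  · split_ifs with h
    · positivity
    · exact le_rfl
  · have hb' : 0 < √b := Real.sqrt_pos.mpr hb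
    split_ifs with h
    · rw [min_eq_left h]
      refine (min_le_left _ _).trans ?_
      have e : a - b = √a ^ 2 - √b ^ 2 := by rw [Real.sq_sqrt ha, Real.sq_sqrt hb.le]
      rw [e]
      have : √b + 1 / (2 * √b) * (√a ^ 2 - √b ^ 2) - √a = (√a - √b) ^ 2 / (2 * √b) := by
        field_simp; ring
      have h2 : 0 ≤ (√a - √b) ^ 2 / (2 * √b) := by positivity
      linarith
    · rw [min_eq_right (le_of_not_ge h)]
      simp

/-- Compressing by contractions on both sides decreases `Tr min(|S|, τ)`. -/
lemma specSum_min_sqrt_compress {τ : ℝ} {L R S : Matrix ι ι ℂ}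
    (hL : (1 - Lᴴ * L).PosSemidef) (hR : (1 - R * Rᴴ).PosSemidef) :
    specSum (fun t => min (√t) τ) ((L * S * R)ᴴ * (L * S * R))
      ≤ specSum (fun t => min (√t) τ) (Sᴴ * S) := by
  have h1 : specSum (fun t => min (√t) τ) ((L * S * R)ᴴ * (L * S * R))
      ≤ specSum (fun t => min (√t) τ) ((S * R)ᴴ * (S * R)) := by
    refine specSum_min_sqrt_le_of_le (posSemidef_conjTranspose_mul_self _)
      (posSemidef_conjTranspose_mul_self _) ?_
    have := hL.conjTranspose_mul_mul_same (S * R)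
    convert this using 1
    simp only [Matrix.conjTranspose_mul, Matrix.mul_assoc, Matrix.mul_sub, Matrix.sub_mul,
      Matrix.one_mul]
  have h2 : specSum (fun t => min (√t) τ) ((S * R) * (S * R)ᴴ)
      ≤ specSum (fun t => min (√t) τ) (S * Sᴴ) := by
    refine specSum_min_sqrt_le_of_le (posSemidef_self_mul_conjTranspose _)
      (posSemidef_self_mul_conjTranspose _) ?_
    have := hR.mul_mul_conjTranspose_same S
    convert this using 1
    simp only [Matrix.conjTranspose_mul, Matrix.mul_assoc, Matrix.mul_sub, Matrix.sub_mul,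
      Matrix.one_mul]
  rw [specSum_mul_comm _ (S * R)ᴴ] at h1
  rw [specSum_mul_comm _ Sᴴ]
  exact h1.trans h2

lemma re_trace_conjTranspose_mul_le {R : ℝ} (hR : 0 ≤ R) {F V : Matrix ι ι ℂ}
    (hF : (((R ^ 2 : ℝ) : ℂ) • (1 : Matrix ι ι ℂ) - Fᴴ * F).PosSemidef) :
    (Fᴴ * V).trace.re ≤ R * specSum (fun t => √t) (Vᴴ * V) := by
  obtain ⟨U, d, hU, hU', hd⟩ := exists_eq_conj_rdiag (posSemidef_conjTranspose_mul_self V).1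
  have h0 := nonneg_of_posSemidef_conj hU hd (posSemidef_conjTranspose_mul_self V)
  rw [hd, specSum_conj_rdiag _ hU, Finset.mul_sum]
  have e : (Fᴴ * V).trace = ((F * U)ᴴ * (V * U)).trace := by
    calc (Fᴴ * V).trace = (Fᴴ * V * (U * Uᴴ)).trace := by rw [hU', Matrix.mul_one]
      _ = (Uᴴ * (Fᴴ * V * U)).trace := by
        rw [← Matrix.mul_assoc, Matrix.trace_mul_comm]
      _ = _ := by simp only [Matrix.conjTranspose_mul, Matrix.mul_assoc]
  rw [e, Matrix.trace, Complex.re_sum]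
  refine Finset.sum_le_sum fun i _ => ?_
  have hV : ∑ k, Complex.normSq ((V * U) k i) = d i := by
    have h := congrFun (congrFun (conj_conj_rdiag hU hd) i) i
    have h' : Uᴴ * (Vᴴ * V) * U = (V * U)ᴴ * (V * U) := by
      simp [Matrix.conjTranspose_mul, Matrix.mul_assoc]
    rw [h', Matrix.mul_apply, rdiag, diagonal_apply_eq] at h
    have h2 := congrArg Complex.re h
    rw [Complex.re_sum, Complex.ofReal_re] at h2
    rw [← h2]
    refine Finset.sum_congr rfl fun k _ => ?_
    simp [Matrix.conjTranspose_apply, Complex.normSq_apply]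
  have hFU : ∑ k, Complex.normSq ((F * U) k i) ≤ R ^ 2 := by
    have h := (hF.conjTranspose_mul_mul_same U).diag_nonneg (i := i)
    have h' : Uᴴ * (((R ^ 2 : ℝ) : ℂ) • (1 : Matrix ι ι ℂ) - Fᴴ * F) * U
        = ((R ^ 2 : ℝ) : ℂ) • (1 : Matrix ι ι ℂ) - (F * U)ᴴ * (F * U) := by
      simp [Matrix.mul_sub, Matrix.sub_mul, Matrix.conjTranspose_mul, Matrix.mul_assoc, hU]
    rw [h', Matrix.sub_apply, Matrix.smul_apply, Matrix.one_apply_eq, Matrix.mul_apply] at h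
    have h2 := (Complex.le_def.mp h).1
    simp only [Complex.zero_re, Complex.sub_re, smul_eq_mul, mul_one, Complex.ofReal_re,
      Complex.re_sum] at h2
    have h3 : ∑ k, Complex.normSq ((F * U) k i)
        = ∑ k, ((F * U)ᴴ i k * (F * U) k i).re :=
      Finset.sum_congr rfl fun k _ => by simp [Matrix.conjTranspose_apply, Complex.normSq_apply]
    linarith
  rw [Matrix.diag_apply, Matrix.mul_apply, Complex.re_sum]
  calc ∑ k, ((F * U)ᴴ i k * (V * U) k i).re
      ≤ ∑ k, ‖(F * U) k i‖ * ‖(V * U) k i‖ := by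
        refine Finset.sum_le_sum fun k _ => ?_
        refine (Complex.re_le_norm _).trans ?_
        rw [norm_mul, Matrix.conjTranspose_apply, norm_star]
    _ ≤ √(∑ k, ‖(F * U) k i‖ ^ 2) * √(∑ k, ‖(V * U) k i‖ ^ 2) :=
        Real.sum_mul_le_sqrt_mul_sqrt _ _ _
    _ ≤ R * √(d i) := by
        simp only [← Complex.normSq_eq_norm_sq]
        rw [hV]
        gcongr
        exact Real.sqrt_le_iff.mpr ⟨hR, hFU⟩

end TraceInequalities

section SignSums

/-- The signed sum `∑ ε_k w_k`. -/
noncomputable def radSum {E : Type*} [AddCommGroup E] [Module ℂ E] {N : ℕ} (w : Fin N → E)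
    (ε : Fin N → Bool) : E :=
  ∑ k, (if ε k then (1 : ℂ) else -1) • w k

lemma radSum_cons {E : Type*} [AddCommGroup E] [Module ℂ E] {N : ℕ} (w : Fin (N + 1) → E)
    (b : Bool) (ε : Fin N → Bool) :
    radSum w (Fin.cons b ε : Fin (N + 1) → Bool)
      = (if b then (1 : ℂ) else -1) • w 0 + radSum (fun k => w k.succ) ε := by
  simp [radSum, Fin.sum_univ_succ]

lemma radSum_add {E : Type*} [AddCommGroup E] [Module ℂ E] {N : ℕ} (v w : Fin N → E)
    (ε : Fin N → Bool) : radSum (fun k => v k + w k) ε = radSum v ε + radSum w ε := by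
  simp [radSum, Finset.sum_add_distrib]

lemma sum_signs_succ {E : Type*} [AddCommMonoid E] {N : ℕ} (f : (Fin (N + 1) → Bool) → E) :
    ∑ ε, f ε = ∑ ε : Fin N → Bool,
      (f (Fin.cons true ε : Fin (N + 1) → Bool) + f (Fin.cons false ε : Fin (N + 1) → Bool)) := by
  rw [← (Fin.consEquiv (fun _ : Fin (N + 1) => Bool)).sum_comp, Fintype.sum_prod_type]
  simp [Finset.sum_add_distrib, Fin.consEquiv]

lemma sum_radSum_mul_radSum {E : Type*} [Ring E] [Algebra ℂ E] {N : ℕ} (a b : Fin N → E) :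
    ∑ ε, radSum a ε * radSum b ε = (2 ^ N : ℕ) • ∑ k, a k * b k := by
  induction N with
  | zero => simp [radSum]
  | succ N ih =>
    rw [sum_signs_succ, Fin.sum_univ_succ, nsmul_add, pow_succ, mul_comm, mul_nsmul, mul_nsmul]
    have := ih (fun k => a k.succ) (fun k => b k.succ)
    rw [← mul_nsmul (∑ i : Fin N, _), mul_comm, mul_nsmul, ← this, Finset.smul_sum]
    have h : ∀ ε : Fin N → Bool,
        radSum a (Fin.cons true ε : Fin (N + 1) → Bool)
            * radSum b (Fin.cons true ε : Fin (N + 1) → Bool)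
          + radSum a (Fin.cons false ε : Fin (N + 1) → Bool)
            * radSum b (Fin.cons false ε : Fin (N + 1) → Bool)
        = 2 • (a 0 * b 0) + 2 • (radSum (fun k => a k.succ) ε * radSum (fun k => b k.succ) ε) := by
      intro ε
      simp only [radSum_cons, if_true, Bool.false_eq_true, if_false, one_smul, neg_smul]
      noncomm_ring
    rw [Finset.sum_congr rfl fun ε _ => h ε, Finset.sum_add_distrib, Finset.sum_const]
    simp

variable {ι : Type*}

lemma radSum_conjTranspose {N : ℕ} (w : Fin N → Matrix ι ι ℂ) (ε : Fin N → Bool) :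
    (radSum w ε)ᴴ = radSum (fun k => (w k)ᴴ) ε := by
  simp only [radSum, Matrix.conjTranspose_sum, Matrix.conjTranspose_smul]
  refine Finset.sum_congr rfl fun k _ => ?_
  split_ifs <;> simp

lemma radSum_apply {N : ℕ} (w : Fin N → Matrix ι ι ℂ) (ε : Fin N → Bool) (i j : ι) :
    radSum w ε i j = radSum (fun k => w k i j) ε := by
  simp only [radSum, Matrix.sum_apply, Matrix.smul_apply]

variable [Fintype ι]

lemma mul_radSum {N : ℕ} (C : Matrix ι ι ℂ) (w : Fin N → Matrix ι ι ℂ) (ε : Fin N → Bool) :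
    C * radSum w ε = radSum (fun k => C * w k) ε := by
  simp [radSum, Finset.mul_sum]

lemma radSum_mul {N : ℕ} (C : Matrix ι ι ℂ) (w : Fin N → Matrix ι ι ℂ) (ε : Fin N → Bool) :
    radSum w ε * C = radSum (fun k => w k * C) ε := by
  simp [radSum, Finset.sum_mul]

variable [DecidableEq ι]

/-- Fourth moment bound:
`E (W W*)² ≤ (∑ w_k w_k*)² + 2 ∑ w_k (∑ w_l* w_l) w_k*` for `W = ∑ ε_k w_k`. -/
lemma fourth_moment_posSemidef {N : ℕ} (w : Fin N → Matrix ι ι ℂ) :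
    ((2 ^ N : ℕ) • ((∑ k, w k * (w k)ᴴ) * (∑ k, w k * (w k)ᴴ)
        + 2 • ∑ k, w k * (∑ l, (w l)ᴴ * w l) * (w k)ᴴ)
      - ∑ ε, (radSum w ε * (radSum w ε)ᴴ) * (radSum w ε * (radSum w ε)ᴴ)).PosSemidef := by
  induction N with
  | zero => simp [radSum, PosSemidef.zero]
  | succ N ih =>
    set w' : Fin N → Matrix ι ι ℂ := fun k => w k.succ with hw'
    set u := w 0 with hu
    have ih' := ih w'
    set A := ∑ k, w' k * (w' k)ᴴ with hA
    set B := ∑ k, (w' k)ᴴ * w' k with hB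
    set G : Matrix ι ι ℂ := ∑ k, w' k * (uᴴ * u) * (w' k)ᴴ with hG
    have e1 : ∑ ε, radSum w' ε * (radSum w' ε)ᴴ = (2 ^ N : ℕ) • A := by
      simp only [radSum_conjTranspose, sum_radSum_mul_radSum, hA]
    have e2 : ∑ ε, (radSum w' ε)ᴴ * radSum w' ε = (2 ^ N : ℕ) • B := by
      simp only [radSum_conjTranspose, sum_radSum_mul_radSum, hB]
    have e3 : ∑ ε, radSum w' ε * (uᴴ * u) * (radSum w' ε)ᴴ = (2 ^ N : ℕ) • G := by
      simp only [radSum_mul (uᴴ * u), radSum_conjTranspose, sum_radSum_mul_radSum, hG]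
    set K : (Fin N → Bool) → Matrix ι ι ℂ := fun ε =>
      radSum w' ε * uᴴ - u * (radSum w' ε)ᴴ with hK
    have hterm : ∀ ε : Fin N → Bool,
        (radSum w (Fin.cons true ε : Fin (N + 1) → Bool)
            * (radSum w (Fin.cons true ε : Fin (N + 1) → Bool))ᴴ)
          * (radSum w (Fin.cons true ε : Fin (N + 1) → Bool)
            * (radSum w (Fin.cons true ε : Fin (N + 1) → Bool))ᴴ)
        + (radSum w (Fin.cons false ε : Fin (N + 1) → Bool)
            * (radSum w (Fin.cons false ε : Fin (N + 1) → Bool))ᴴ)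
          * (radSum w (Fin.cons false ε : Fin (N + 1) → Bool)
            * (radSum w (Fin.cons false ε : Fin (N + 1) → Bool))ᴴ)
        = 2 • ((radSum w' ε * (radSum w' ε)ᴴ) * (radSum w' ε * (radSum w' ε)ᴴ))
          + 2 • ((radSum w' ε * (radSum w' ε)ᴴ) * (u * uᴴ))
          + 2 • ((u * uᴴ) * (radSum w' ε * (radSum w' ε)ᴴ))
          + 2 • ((u * uᴴ) * (u * uᴴ))
          + 4 • (radSum w' ε * (uᴴ * u) * (radSum w' ε)ᴴ)
          + 4 • (u * ((radSum w' ε)ᴴ * radSum w' ε) * uᴴ)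
          - 2 • (K ε * (K ε)ᴴ) := by
      intro ε
      simp only [radSum_cons, if_true, Bool.false_eq_true, if_false, one_smul, neg_smul, hK,
        Matrix.conjTranspose_add, Matrix.conjTranspose_sub, Matrix.conjTranspose_mul,
        Matrix.conjTranspose_conjTranspose, Matrix.conjTranspose_neg, ← hu]
      rw [← hw']
      generalize radSum w' ε = X
      noncomm_ring
    have hKps : (∑ ε, K ε * (K ε)ᴴ).PosSemidef :=
      posSemidef_sum _ fun ε _ => posSemidef_self_mul_conjTranspose _
    have hQps : ((u * uᴴ) * (u * uᴴ)).PosSemidef := by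
      have := posSemidef_self_mul_conjTranspose (u * uᴴ)
      rwa [Matrix.conjTranspose_mul, Matrix.conjTranspose_conjTranspose] at this
    have hQps' : ((4 * 2 ^ N) • ((u * uᴴ) * (u * uᴴ))).PosSemidef := by
      have := posSemidef_sum (Finset.range (4 * 2 ^ N)) fun _ _ => hQps
      rwa [Finset.sum_const, Finset.card_range] at this
    have hfin := ((ih'.add ih').add (hKps.add hKps)).add hQps'
    convert hfin using 1
    rw [sum_signs_succ, Finset.sum_congr rfl fun ε _ => hterm ε]
    simp only [Finset.sum_add_distrib, Finset.sum_sub_distrib, ← Finset.smul_sum,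
      ← Finset.mul_sum, ← Finset.sum_mul, e1, e2, e3, Finset.sum_const, Fin.sum_univ_succ]
    have e4 : ∑ k : Fin N, w k.succ * (uᴴ * u + ∑ l : Fin N, (w l.succ)ᴴ * w l.succ)
        * (w k.succ)ᴴ = G + ∑ k, w' k * B * (w' k)ᴴ := by
      rw [hG, ← Finset.sum_add_distrib]
      refine Finset.sum_congr rfl fun k _ => ?_
      rw [Matrix.mul_add, Matrix.add_mul]
    rw [e4]
    change (2 ^ (N + 1)) • ((u * uᴴ + A) * (u * uᴴ + A)
      + 2 • (u * (uᴴ * u + B) * uᴴ + (G + ∑ k, w' k * B * (w' k)ᴴ))) - _ = _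
    simp only [Finset.card_univ, Fintype.card_pi, Fintype.card_bool, Finset.prod_const,
      Fintype.card_fin]
    generalize ∑ k, w' k * B * (w' k)ᴴ = H
    generalize (∑ ε, radSum w' ε * (radSum w' ε)ᴴ * (radSum w' ε * (radSum w' ε)ᴴ)) = Y
    generalize (∑ ε, K ε * (K ε)ᴴ) = Z
    rw [pow_succ]
    generalize 2 ^ N = m
    simp only [smul_mul_assoc, mul_smul_comm]
    simp only [Matrix.add_mul, Matrix.mul_add, smul_add, Matrix.mul_assoc]
    module

end SignSums

section Truncation

variable {ι : Type*} [Fintype ι] [DecidableEq ι]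

lemma posSemidef_one_sub_sq {A : Matrix ι ι ℂ} (hA : A.PosSemidef) (hA1 : (1 - A).PosSemidef) :
    (1 - A * A).PosSemidef := by
  have h1 := hA1.conjTranspose_mul_mul_same A
  have h2 := hA.conjTranspose_mul_mul_same (1 - A)
  have := (hA1.add h1).add h2
  convert this using 1
  rw [hA1.1.eq, hA.1.eq]
  noncomm_ring

lemma sum_re_trace_mul_fourth_le {N : ℕ} {D : Matrix ι ι ℂ} (hD : D.PosSemidef)
    (w : Fin N → Matrix ι ι ℂ) (h1 : (1 - ∑ k, w k * (w k)ᴴ).PosSemidef)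
    (h2 : (1 - ∑ k, (w k)ᴴ * w k).PosSemidef) :
    ∑ ε, (D * ((radSum w ε * (radSum w ε)ᴴ) * (radSum w ε * (radSum w ε)ᴴ))).trace.re
      ≤ 2 ^ N * (3 * D.trace.re) := by
  set A := ∑ k, w k * (w k)ᴴ with hA
  set B := ∑ k, (w k)ᴴ * w k with hB
  have hAps : A.PosSemidef := posSemidef_sum _ fun k _ => posSemidef_self_mul_conjTranspose _
  have h3 : (D * (A * A)).trace.re ≤ D.trace.re := by
    simpa using re_trace_mul_le_of_sub hD (posSemidef_one_sub_sq hAps h1)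
  have h4 : (D * ∑ k, w k * B * (w k)ᴴ).trace.re ≤ D.trace.re := by
    have : (A - ∑ k, w k * B * (w k)ᴴ).PosSemidef := by
      rw [hA, ← Finset.sum_sub_distrib]
      refine posSemidef_sum _ fun k _ => ?_
      have := h2.mul_mul_conjTranspose_same (w k)
      rwa [Matrix.mul_sub, Matrix.sub_mul, Matrix.mul_one] at this
    refine (re_trace_mul_le_of_sub hD this).trans ?_
    simpa using re_trace_mul_le_of_sub hD h1
  have h5 := re_trace_mul_le_of_sub hD (fourth_moment_posSemidef w)
  rw [Finset.mul_sum, Matrix.trace_sum, Complex.re_sum] at h5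
  refine h5.trans ?_
  rw [Matrix.mul_smul, Matrix.trace_smul, Matrix.mul_add, Matrix.trace_add, Matrix.mul_smul,
    Matrix.trace_smul]
  simp only [nsmul_eq_mul, Complex.mul_re, Complex.add_re, Complex.natCast_re, Complex.natCast_im,
    zero_mul, sub_zero]
  push_cast
  gcongr
  rw [← hA, ← hB]
  linarith

/-- Smooth truncation of `W` at level `R`. -/
lemma exists_truncation {R : ℝ} (hR : 0 < R) {D : Matrix ι ι ℂ} (hD : D.PosSemidef)
    (W : Matrix ι ι ℂ) :
    ∃ F : Matrix ι ι ℂ, (((R ^ 2 : ℝ) : ℂ) • (1 : Matrix ι ι ℂ) - Fᴴ * F).PosSemidef ∧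
      (Wᴴ * (D * W + W * D)).trace.re ≤ (Fᴴ * (D * W + W * D)).trace.re
        + (1 / R ^ 2) * ((D * ((W * Wᴴ) * (W * Wᴴ))).trace.re
          + (D * ((Wᴴ * W) * (Wᴴ * W))).trace.re) := by
  obtain ⟨U, s, hU, hU', hs⟩ := exists_eq_conj_rdiag (posSemidef_conjTranspose_mul_self W).1
  have h0 := nonneg_of_posSemidef_conj hU hs (posSemidef_conjTranspose_mul_self W)
  set x : ι → ℝ := fun i => s i / R ^ 2 with hx
  have hx0 : ∀ i, 0 ≤ x i := fun i => by have := h0 i; positivity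
  set Q := U * rdiag (fun i => (1 + x i)⁻¹) * Uᴴ with hQ
  set P := U * rdiag (fun i => x i / (1 + x i)) * Uᴴ with hP
  have hQh : Qᴴ = Q := conj_rdiag_conjTranspose _ _
  have hPh : Pᴴ = P := conj_rdiag_conjTranspose _ _
  have hsum : ∀ d e : ι → ℝ, U * rdiag d * Uᴴ - U * rdiag e * Uᴴ
      = U * rdiag (fun i => d i - e i) * Uᴴ := by
    intro d e
    rw [← Matrix.sub_mul, ← Matrix.mul_sub]
    congr 2
    simp [rdiag, Matrix.diagonal_sub]
  have hone : ∀ c : ℝ, (c : ℂ) • (1 : Matrix ι ι ℂ) = U * rdiag (fun _ => c) * Uᴴ := by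
    intro c
    have : rdiag (fun _ : ι => c) = (c : ℂ) • (1 : Matrix ι ι ℂ) := by
      rw [rdiag, Matrix.smul_one_eq_diagonal]
    rw [this, Matrix.mul_smul, Matrix.smul_mul, Matrix.mul_one, hU']
  have hPQ : W - W * Q = W * P := by
    have : P = 1 - Q := by
      have := hone 1
      rw [Complex.ofReal_one, one_smul] at this
      rw [hP, this, hQ, hsum]
      congr 3
      funext i
      have := hx0 i
      field_simp
      ring
    rw [this, Matrix.mul_sub, Matrix.mul_one]
  refine ⟨W * Q, ?_, ?_⟩
  · have : (W * Q)ᴴ * (W * Q) = U * rdiag (fun i => (1 + x i)⁻¹ * s i * (1 + x i)⁻¹) * Uᴴ := by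
      rw [Matrix.conjTranspose_mul, hQh, Matrix.mul_assoc, ← Matrix.mul_assoc Wᴴ, hs, hQ,
        conj_rdiag_mul hU, conj_rdiag_mul hU]
      simp only [mul_assoc]
    rw [this, hone, hsum]
    refine posSemidef_conj_rdiag U fun i => ?_
    have h1 := hx0 i
    have h2 : s i = R ^ 2 * x i := by rw [hx]; field_simp
    rw [h2]
    have : R ^ 2 - (1 + x i)⁻¹ * (R ^ 2 * x i) * (1 + x i)⁻¹
        = R ^ 2 * ((1 + x i + x i ^ 2) / (1 + x i) ^ 2) := by field_simp; ring
    rw [this]; positivity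
  · have e1 : (Wᴴ * (D * W + W * D)).trace = ((W * Q)ᴴ * (D * W + W * D)).trace
        + ((D * (W * P * Wᴴ)).trace + (D * (P * (Wᴴ * W))).trace) := by
      have : Wᴴ = (W * Q)ᴴ + P * Wᴴ := by
        have h := congrArg Matrix.conjTranspose hPQ
        rw [Matrix.conjTranspose_sub, Matrix.conjTranspose_mul W P, hPh] at h
        rw [← h]; abel
      have h1 : (P * Wᴴ * (D * W)).trace = (D * (W * P * Wᴴ)).trace := by
        rw [← Matrix.mul_assoc, Matrix.trace_mul_comm, ← Matrix.mul_assoc, Matrix.trace_mul_comm]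
        simp only [Matrix.mul_assoc]
      have h2 : (P * Wᴴ * (W * D)).trace = (D * (P * (Wᴴ * W))).trace := by
        rw [Matrix.trace_mul_comm D]; simp only [Matrix.mul_assoc]
      conv_lhs => rw [this]
      rw [Matrix.add_mul, Matrix.trace_add, Matrix.mul_add (P * Wᴴ), Matrix.trace_add, h1, h2]
    rw [e1]
    simp only [Complex.add_re]
    have h1 : (D * (W * P * Wᴴ)).trace.re ≤ (1 / R ^ 2) * (D * ((W * Wᴴ) * (W * Wᴴ))).trace.re := by
      have e : ((1 / R ^ 2 : ℝ) : ℂ) • ((W * Wᴴ) * (W * Wᴴ))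
          = W * (U * rdiag x * Uᴴ) * Wᴴ := by
        have : U * rdiag x * Uᴴ = ((1 / R ^ 2 : ℝ) : ℂ) • (Wᴴ * W) := by
          rw [hs, ← Matrix.smul_mul, ← Matrix.mul_smul]
          congr 2
          simp [rdiag, ← Matrix.diagonal_smul, hx, div_eq_inv_mul, Pi.smul_def]
        rw [this]
        simp only [Matrix.mul_smul, Matrix.smul_mul, Matrix.mul_assoc]
      have hps : (((1 / R ^ 2 : ℝ) : ℂ) • ((W * Wᴴ) * (W * Wᴴ)) - W * P * Wᴴ).PosSemidef := by
        rw [e, ← Matrix.sub_mul, ← Matrix.mul_sub, hP, hsum]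
        refine (posSemidef_conj_rdiag U fun i => ?_).mul_mul_conjTranspose_same W
        have := hx0 i
        have e : x i - x i / (1 + x i) = x i ^ 2 / (1 + x i) := by field_simp; ring
        rw [e]; positivity
      have := re_trace_mul_le_of_sub hD hps
      rwa [Matrix.mul_smul, Matrix.trace_smul, smul_eq_mul, Complex.re_ofReal_mul] at this
    have h2 : (D * (P * (Wᴴ * W))).trace.re ≤ (1 / R ^ 2) * (D * ((Wᴴ * W) * (Wᴴ * W))).trace.re := by
      have hps : (((1 / R ^ 2 : ℝ) : ℂ) • ((Wᴴ * W) * (Wᴴ * W)) - P * (Wᴴ * W)).PosSemidef := by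
        have e : ((1 / R ^ 2 : ℝ) : ℂ) • ((Wᴴ * W) * (Wᴴ * W))
            = U * rdiag (fun i => R ^ 2 * x i * x i) * Uᴴ := by
          rw [hs, conj_rdiag_mul hU, ← Matrix.smul_mul, ← Matrix.mul_smul]
          congr 2
          rw [rdiag, rdiag, ← Matrix.diagonal_smul]
          congr 1
          funext i
          simp only [Pi.smul_apply, smul_eq_mul, hx]
          push_cast
          field_simp
        rw [e, hs, hP, conj_rdiag_mul hU, hsum]
        refine posSemidef_conj_rdiag U fun i => ?_
        have h1 := hx0 i
        have h2 : s i = R ^ 2 * x i := by rw [hx]; field_simp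
        rw [h2]
        have e : R ^ 2 * x i * x i - x i / (1 + x i) * (R ^ 2 * x i)
          = R ^ 2 * (x i ^ 3 / (1 + x i)) := by field_simp; ring
        rw [e]; positivity
      have := re_trace_mul_le_of_sub hD hps
      rwa [Matrix.mul_smul, Matrix.trace_smul, smul_eq_mul, Complex.re_ofReal_mul] at this
    linarith

end Truncation

section SquareRootMinimizer

variable {ι : Type*} [Fintype ι] [DecidableEq ι]

lemma specSum_sqrt_le {X V : Matrix ι ι ℂ} {b : ι → ℝ} (hX : X.PosSemidef) (hV : Vᴴ * V = 1)
    (hV' : V * Vᴴ = 1) (hb : ∀ i, 0 < b i) :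
    specSum (fun t => √t) X ≤
      ∑ j, √(b j) / 2 + (X * (V * rdiag (fun j => 1 / (2 * √(b j))) * Vᴴ)).trace.re := by
  obtain ⟨U, d, hU, hU', hd⟩ := exists_eq_conj_rdiag hX.1
  have h0 := nonneg_of_posSemidef_conj hU hd hX
  rw [hd]
  refine specSum_le_of_pointwise hU hU' hV hV' fun i j _ => ?_
  have h1 : 0 < √(b j) := Real.sqrt_pos.mpr (hb j)
  have h2 : √(b j) / 2 + 1 / (2 * √(b j)) * d i - √(d i)
      = (√(d i) - √(b j)) ^ 2 / (2 * √(b j)) := by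
    have h3 := Real.sq_sqrt (h0 i)
    have h4 := Real.sq_sqrt (hb j).le
    field_simp
    linear_combination -h3
  have h3 : 0 ≤ (√(d i) - √(b j)) ^ 2 / (2 * √(b j)) := by positivity
  linarith

lemma norm_conj_rdiag_apply_le {V : Matrix ι ι ℂ} {g : ι → ℝ} {c : ℝ} (hV' : V * Vᴴ = 1)
    (hg : ∀ i, |g i| ≤ c) (i j : ι) :
    ‖(V * rdiag g * Vᴴ) i j‖ ≤ Fintype.card ι * c := by
  have h1 : ∀ i l, ‖V i l‖ ≤ 1 := by
    intro i l
    have h := Finset.single_le_sum (f := fun l => Complex.normSq (V i l))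
      (fun l _ => Complex.normSq_nonneg _) (Finset.mem_univ l)
    rw [sum_normSq_row hV' i] at h
    simp only [Complex.normSq_eq_norm_sq] at h
    exact (sq_le_one_iff₀ (norm_nonneg _)).mp h
  rw [Matrix.mul_apply]
  refine (norm_sum_le _ _).trans ?_
  rw [← nsmul_eq_mul, ← Finset.card_univ]
  refine Finset.sum_le_card_nsmul _ _ _ fun l _ => ?_
  rw [rdiag, Matrix.mul_diagonal, Matrix.conjTranspose_apply, norm_mul, norm_mul, norm_star,
    Complex.norm_real, Real.norm_eq_abs]
  have hc : 0 ≤ c := (abs_nonneg _).trans (hg l)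
  calc ‖V i l‖ * |g l| * ‖V j l‖ ≤ 1 * c * 1 := by
        gcongr
        · exact h1 i l
        · exact hg l
        · exact h1 j l
    _ = c := by ring

lemma le_of_posSemidef_sub_smul_one {B U : Matrix ι ι ℂ} {b : ι → ℝ} {δ : ℝ} (hU : Uᴴ * U = 1)
    (hb : B = U * rdiag b * Uᴴ) (h : (B - (δ : ℂ) • (1 : Matrix ι ι ℂ)).PosSemidef) (i : ι) :
    δ ≤ b i := by
  have h1 := (h.conjTranspose_mul_mul_same U).diag_nonneg (i := i)
  rw [Matrix.mul_sub, Matrix.sub_mul, conj_conj_rdiag hU hb, Matrix.mul_smul, Matrix.smul_mul,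
    Matrix.mul_one, hU] at h1
  simp only [Matrix.sub_apply, rdiag, Matrix.diagonal_apply_eq, Matrix.smul_apply,
    Matrix.one_apply_eq, smul_eq_mul, mul_one, ← Complex.ofReal_sub] at h1
  have := Complex.zero_le_real.mp h1
  linarith

lemma specSum_sqrt_sub_le {δ : ℝ} (hδ : 0 < δ) {A B : Matrix ι ι ℂ} (hA : A.PosSemidef)
    (hB : B.PosSemidef) (h : (B - (δ : ℂ) • (1 : Matrix ι ι ℂ)).PosSemidef) :
    specSum (fun t => √t) A - specSum (fun t => √t) B
      ≤ (Fintype.card ι * (1 / (2 * √δ))) * ∑ i, ∑ j, ‖(A - B) i j‖ := by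
  obtain ⟨U, b, hU, hU', hb⟩ := exists_eq_conj_rdiag hB.1
  have hbδ := le_of_posSemidef_sub_smul_one hU hb h
  have hb0 : ∀ i, 0 < b i := fun i => hδ.trans_le (hbδ i)
  have h1 := specSum_sqrt_le hA hU hU' hb0
  set Y := U * rdiag (fun j => 1 / (2 * √(b j))) * Uᴴ with hY
  have h2 : (B * Y).trace.re = ∑ j, √(b j) / 2 := by
    rw [hY, hb, conj_rdiag_mul hU, trace_conj_rdiag hU, Complex.re_sum]
    refine Finset.sum_congr rfl fun j _ => ?_
    rw [Complex.ofReal_re]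
    have := Real.sqrt_pos.mpr (hb0 j)
    nth_rewrite 1 [← Real.sq_sqrt (hb0 j).le]
    field_simp
  have h3 : specSum (fun t => √t) B = ∑ j, √(b j) := by rw [hb, specSum_conj_rdiag _ hU]
  have h4 : ∑ j, √(b j) = ∑ j, √(b j) / 2 + ∑ j, √(b j) / 2 := by
    rw [← Finset.sum_add_distrib]; exact Finset.sum_congr rfl fun j _ => by ring
  have h5 : ((A - B) * Y).trace.re ≤
      (Fintype.card ι * (1 / (2 * √δ))) * ∑ i, ∑ j, ‖(A - B) i j‖ := by
    rw [Matrix.trace, Complex.re_sum, Finset.mul_sum]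
    refine Finset.sum_le_sum fun i _ => ?_
    rw [Matrix.diag_apply, Matrix.mul_apply, Complex.re_sum, Finset.mul_sum]
    refine Finset.sum_le_sum fun j _ => ?_
    refine (Complex.re_le_norm _).trans ?_
    rw [norm_mul, mul_comm]
    gcongr
    refine norm_conj_rdiag_apply_le hU' (fun l => ?_) j i
    rw [abs_of_nonneg (by positivity)]
    have := hbδ l
    gcongr
  rw [Matrix.sub_mul, Matrix.trace_sub, Complex.sub_re] at h5
  linarith

lemma trace_re_le_specSum_sqrt_sq {A : Matrix ι ι ℂ} (hA : A.PosSemidef) :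
    A.trace.re ≤ specSum (fun t => √t) A ^ 2 := by
  obtain ⟨U, d, hU, -, hd⟩ := exists_eq_conj_rdiag hA.1
  have h0 := nonneg_of_posSemidef_conj hU hd hA
  rw [hd, specSum_conj_rdiag _ hU, trace_conj_rdiag hU, Complex.re_sum]
  calc ∑ i, ((d i : ℂ)).re = ∑ i, √(d i) ^ 2 :=
        Finset.sum_congr rfl fun i _ => by rw [Complex.ofReal_re, Real.sq_sqrt (h0 i)]
    _ ≤ _ := Finset.sum_sq_le_sq_sum_of_nonneg fun i _ => Real.sqrt_nonneg _

variable {N : ℕ}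

/-- The matrix `∑ α_k α_k* + ∑ (v_k - α_k)* (v_k - α_k) + δ`. -/
noncomputable def splitGram (δ : ℝ) (v α : Fin N → Matrix ι ι ℂ) : Matrix ι ι ℂ :=
  ∑ k, α k * (α k)ᴴ + ∑ k, (v k - α k)ᴴ * (v k - α k) + (δ : ℂ) • (1 : Matrix ι ι ℂ)

lemma splitGram_sub_posSemidef (δ : ℝ) (v α : Fin N → Matrix ι ι ℂ) :
    (splitGram δ v α - (δ : ℂ) • (1 : Matrix ι ι ℂ)).PosSemidef := by
  rw [splitGram, add_sub_cancel_right]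
  exact (posSemidef_sum _ fun k _ => posSemidef_self_mul_conjTranspose _).add
    (posSemidef_sum _ fun k _ => posSemidef_conjTranspose_mul_self _)

lemma splitGram_posSemidef {δ : ℝ} (hδ : 0 < δ) (v α : Fin N → Matrix ι ι ℂ) :
    (splitGram δ v α).PosSemidef := by
  have h : ((δ : ℂ) • (1 : Matrix ι ι ℂ)).PosSemidef :=
    PosSemidef.one.smul (by exact_mod_cast hδ.le)
  simpa using (splitGram_sub_posSemidef δ v α).add h

lemma continuous_splitGram (δ : ℝ) (v : Fin N → Matrix ι ι ℂ) :
    Continuous fun α : Fin N → Matrix ι ι ℂ => splitGram δ v α := by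
  unfold splitGram
  fun_prop

lemma continuous_specSum_sqrt_splitGram {δ : ℝ} (hδ : 0 < δ) (v : Fin N → Matrix ι ι ℂ) :
    Continuous fun α : Fin N → Matrix ι ι ℂ => specSum (fun t => √t) (splitGram δ v α) := by
  rw [continuous_iff_continuousAt]
  intro α
  rw [ContinuousAt, tendsto_iff_dist_tendsto_zero]
  set c : ℝ := Fintype.card ι * (1 / (2 * √δ)) with hc
  have h1 : Filter.Tendsto (fun β : Fin N → Matrix ι ι ℂ => c * ∑ i, ∑ j,
      ‖(splitGram δ v β - splitGram δ v α) i j‖) (nhds α) (nhds 0) := by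
    have hcont : Continuous (fun β : Fin N → Matrix ι ι ℂ => c * ∑ i, ∑ j,
      ‖(splitGram δ v β - splitGram δ v α) i j‖) := by
      have := continuous_splitGram δ v
      simp only [Matrix.sub_apply]
      fun_prop
    have := hcont.tendsto α
    simpa using this
  refine squeeze_zero (fun _ => dist_nonneg) (fun β => ?_) h1
  rw [Real.dist_eq, abs_sub_le_iff]
  refine ⟨specSum_sqrt_sub_le hδ (splitGram_posSemidef hδ v β) (splitGram_posSemidef hδ v α)
    (splitGram_sub_posSemidef δ v α), ?_⟩
  refine (specSum_sqrt_sub_le hδ (splitGram_posSemidef hδ v α) (splitGram_posSemidef hδ v β)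
    (splitGram_sub_posSemidef δ v β)).trans_eq ?_
  rw [← hc]
  congr 1
  refine Finset.sum_congr rfl fun i _ => Finset.sum_congr rfl fun j _ => ?_
  rw [Matrix.sub_apply, Matrix.sub_apply, norm_sub_rev]

lemma norm_apply_le_specSum_sqrt {δ : ℝ} (hδ : 0 < δ) (v α : Fin N → Matrix ι ι ℂ) (k : Fin N)
    (i j : ι) : ‖α k i j‖ ≤ specSum (fun t => √t) (splitGram δ v α) := by
  have h0 : 0 ≤ specSum (fun t => √t) (splitGram δ v α) :=
    specSum_nonneg (splitGram_posSemidef hδ v α) fun t _ => Real.sqrt_nonneg t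
  refine (sq_le_sq₀ (norm_nonneg _) h0).mp (le_trans ?_
    (trace_re_le_specSum_sqrt_sq (splitGram_posSemidef hδ v α)))
  have h1 : ‖α k i j‖ ^ 2 ≤ (α k * (α k)ᴴ).trace.re := by
    rw [Matrix.trace, Complex.re_sum]
    have hterm : ∀ i, (Matrix.diag (α k * (α k)ᴴ) i).re = ∑ j, ‖α k i j‖ ^ 2 := by
      intro i
      rw [Matrix.diag_apply, Matrix.mul_apply, Complex.re_sum]
      refine Finset.sum_congr rfl fun j _ => ?_
      rw [Matrix.conjTranspose_apply, ← Complex.normSq_eq_norm_sq]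
      simp [Complex.normSq_apply]
    simp only [hterm]
    calc ‖α k i j‖ ^ 2 ≤ ∑ j, ‖α k i j‖ ^ 2 :=
          Finset.single_le_sum (f := fun j => ‖α k i j‖ ^ 2) (fun _ _ => by positivity)
            (Finset.mem_univ j)
      _ ≤ _ := Finset.single_le_sum (f := fun i => ∑ j, ‖α k i j‖ ^ 2)
            (fun _ _ => Finset.sum_nonneg fun _ _ => by positivity) (Finset.mem_univ i)
  have hnn : ∀ M : Matrix ι ι ℂ, M.PosSemidef → 0 ≤ M.trace.re := fun M hM => by
    simpa using re_trace_mul_nonneg PosSemidef.one hM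
  refine h1.trans ?_
  rw [splitGram, Matrix.trace_add, Matrix.trace_add, Complex.add_re, Complex.add_re,
    Matrix.trace_sum, Complex.re_sum]
  have h2 := Finset.single_le_sum (f := fun k => (α k * (α k)ᴴ).trace.re)
    (fun l _ => hnn _ (posSemidef_self_mul_conjTranspose (α l))) (Finset.mem_univ k)
  have h3 := hnn _ (posSemidef_sum Finset.univ
    fun k _ => posSemidef_conjTranspose_mul_self (v k - α k))
  have h4 := hnn _ (PosSemidef.one.smul (by exact_mod_cast hδ.le : (0 : ℂ) ≤ (δ : ℂ)))
  linarith

lemma exists_isMin_specSum_sqrt_splitGram {δ : ℝ} (hδ : 0 < δ) (v : Fin N → Matrix ι ι ℂ) :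
    ∃ α, ∀ β, specSum (fun t => √t) (splitGram δ v α) ≤ specSum (fun t => √t) (splitGram δ v β) := by
  let f : (Fin N → ι → ι → ℂ) → ℝ := fun α =>
    specSum (fun t => √t) (splitGram δ v fun k => Matrix.of (α k))
  have hf : Continuous f := continuous_specSum_sqrt_splitGram hδ v
  have hlim : Filter.Tendsto f (Filter.cocompact _) Filter.atTop := by
    refine Filter.tendsto_atTop_mono (fun α => ?_)
      (tendsto_norm_cocompact_atTop (E := Fin N → ι → ι → ℂ))
    have h0 : 0 ≤ f α :=
      specSum_nonneg (splitGram_posSemidef hδ v _) fun t _ => Real.sqrt_nonneg t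
    refine (pi_norm_le_iff_of_nonneg h0).mpr fun k => (pi_norm_le_iff_of_nonneg h0).mpr fun i =>
      (pi_norm_le_iff_of_nonneg h0).mpr fun j => ?_
    exact norm_apply_le_specSum_sqrt hδ v (fun k => Matrix.of (α k)) k i j
  obtain ⟨α, hα⟩ := hf.exists_forall_le hlim
  exact ⟨fun k => Matrix.of (α k), fun β => hα fun k => β k⟩

end SquareRootMinimizer

section Sylvester

variable {ι : Type*} [Fintype ι] [DecidableEq ι] {N : ℕ}

lemma re_trace_conjTranspose {κ : Type*} [Fintype κ] (A : Matrix κ κ ℂ) : (Aᴴ).trace.re = A.trace.re := by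
  rw [Matrix.trace_conjTranspose]; simp

lemma eq_zero_of_linear_quadratic {L Q : ℝ} (hL : 0 ≤ L)
    (h : ∀ t : ℝ, 0 < t → t * L ≤ t ^ 2 * Q) : L = 0 := by
  by_contra hne
  have hL' : 0 < L := lt_of_le_of_ne hL (Ne.symm hne)
  have hQ : 0 < Q := by have := h 1 one_pos; linarith
  have := h (L / (2 * Q)) (by positivity)
  have e : (L / (2 * Q)) ^ 2 * Q = (L / (2 * Q)) * (L / 2) := by field_simp
  rw [e] at this
  have := le_of_mul_le_mul_left this (by positivity : 0 < L / (2 * Q))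
  linarith

lemma splitGram_sub_smul (δ t : ℝ) (v α h : Fin N → Matrix ι ι ℂ) :
    splitGram δ v (fun k => α k - (t : ℂ) • h k) = splitGram δ v α
      - (t : ℂ) • ∑ k, ((α k * (h k)ᴴ + h k * (α k)ᴴ)
          - ((h k)ᴴ * (v k - α k) + (v k - α k)ᴴ * h k))
      + ((t ^ 2 : ℝ) : ℂ) • ∑ k, (h k * (h k)ᴴ + (h k)ᴴ * h k) := by
  have e : ∀ k, (α k - (t : ℂ) • h k) * (α k - (t : ℂ) • h k)ᴴ
      + (v k - (α k - (t : ℂ) • h k))ᴴ * (v k - (α k - (t : ℂ) • h k))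
      = (α k * (α k)ᴴ + (v k - α k)ᴴ * (v k - α k))
        - (t : ℂ) • ((α k * (h k)ᴴ + h k * (α k)ᴴ)
          - ((h k)ᴴ * (v k - α k) + (v k - α k)ᴴ * h k))
        + ((t ^ 2 : ℝ) : ℂ) • (h k * (h k)ᴴ + (h k)ᴴ * h k) := by
    intro k
    have : v k - (α k - (t : ℂ) • h k) = (v k - α k) + (t : ℂ) • h k := by abel
    rw [this]
    generalize v k - α k = β
    simp only [Matrix.conjTranspose_add, Matrix.conjTranspose_sub, Matrix.conjTranspose_smul,
      Matrix.mul_add, Matrix.add_mul, Matrix.mul_sub, Matrix.sub_mul, Matrix.smul_mul,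
      Matrix.mul_smul, Complex.star_def, Complex.conj_ofReal]
    push_cast
    module
  simp only [splitGram, ← Finset.sum_add_distrib]
  rw [Finset.sum_congr rfl fun k _ => e k, Finset.sum_add_distrib, Finset.sum_sub_distrib,
    ← Finset.smul_sum, ← Finset.smul_sum]
  abel

/-- Solution of the Sylvester equations `v_k = D w_k + w_k D` with `D > 0` chosen so that
`∑ w_k w_k* + ∑ w_k* w_k ≤ 1`, together with the almost sharp trace identity for `D`. -/
lemma exists_sylvester {δ : ℝ} (hδ : 0 < δ) (v : Fin N → Matrix ι ι ℂ) :
    ∃ (U : Matrix ι ι ℂ) (d : ι → ℝ) (w : Fin N → Matrix ι ι ℂ),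
      Uᴴ * U = 1 ∧ U * Uᴴ = 1 ∧ (∀ i, 0 < d i) ∧
      (∀ k, v k = (U * rdiag d * Uᴴ) * w k + w k * (U * rdiag d * Uᴴ)) ∧
      (1 - ∑ k, w k * (w k)ᴴ).PosSemidef ∧ (1 - ∑ k, (w k)ᴴ * w k).PosSemidef ∧
      ∑ i, d i ≤ ∑ k, ((w k)ᴴ * v k).trace.re + Fintype.card ι * √δ := by
  obtain ⟨α, hα⟩ := exists_isMin_specSum_sqrt_splitGram hδ v
  have hBps := splitGram_posSemidef hδ v α
  set B := splitGram δ v α with hB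
  obtain ⟨U, b, hU, hU', hb⟩ := exists_eq_conj_rdiag hBps.1
  have hbδ := le_of_posSemidef_sub_smul_one hU hb (splitGram_sub_posSemidef δ v α)
  have hb0 : ∀ i, 0 < b i := fun i => hδ.trans_le (hbδ i)
  have hs0 : ∀ i, 0 < √(b i) := fun i => Real.sqrt_pos.mpr (hb0 i)
  set D := U * rdiag (fun i => √(b i)) * Uᴴ with hD
  set E := U * rdiag (fun i => 1 / √(b i)) * Uᴴ with hE
  have hone : U * rdiag (fun _ => (1 : ℝ)) * Uᴴ = 1 := by
    rw [rdiag_one, Matrix.mul_one, hU']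
  have hDE : D * E = 1 := by
    rw [hD, hE, conj_rdiag_mul hU, ← hone]
    congr 3; funext i; have := hs0 i; field_simp
  have hED : E * D = 1 := by
    rw [hD, hE, conj_rdiag_mul hU, ← hone]
    congr 3; funext i; have := hs0 i; field_simp
  have hDD : D * D = B := by
    rw [hD, hb, conj_rdiag_mul hU]
    congr 3; funext i; exact Real.mul_self_sqrt (hb0 i).le
  have hDh : Dᴴ = D := conj_rdiag_conjTranspose _ _
  have hEh : Eᴴ = E := conj_rdiag_conjTranspose _ _
  have hEps : E.PosSemidef := posSemidef_conj_rdiag U fun i => by positivity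
  clear_value D E
  -- `α` also minimizes the linearization
  have hmin : ∀ β, (B * E).trace.re ≤ (splitGram δ v β * E).trace.re := by
    intro β
    have h1 := (hα β).trans (specSum_sqrt_le (splitGram_posSemidef hδ v β) hU hU' hb0)
    have h2 : specSum (fun t => √t) B = ∑ j, √(b j) := by rw [hb, specSum_conj_rdiag _ hU]
    have h3 : (B * E).trace.re = ∑ j, √(b j) := by
      rw [← hDD, Matrix.mul_assoc, hDE, Matrix.mul_one, hD, trace_conj_rdiag hU]; simp
    have h4 : U * rdiag (fun j => 1 / (2 * √(b j))) * Uᴴ = ((1 / 2 : ℝ) : ℂ) • E := by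
      rw [hE, ← Matrix.smul_mul, ← Matrix.mul_smul]
      congr 2
      rw [rdiag, rdiag, ← Matrix.diagonal_smul]
      congr 1
      funext i
      simp only [Pi.smul_apply, smul_eq_mul]
      push_cast
      rw [one_div_mul_one_div]
    rw [h2, h4, ← Finset.sum_div, Matrix.mul_smul, Matrix.trace_smul, smul_eq_mul,
      Complex.re_ofReal_mul] at h1
    rw [h3]
    linarith
  set β : Fin N → Matrix ι ι ℂ := fun k => v k - α k with hβ
  set Δ : Fin N → Matrix ι ι ℂ := fun k => E * α k - β k * E with hΔ
  have hΔ0 : ∑ k, ((Δ k)ᴴ * Δ k).trace.re = 0 := by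
    refine eq_zero_of_linear_quadratic
      (Q := ((∑ k, (Δ k * (Δ k)ᴴ + (Δ k)ᴴ * Δ k)) * E).trace.re / 2)
      (Finset.sum_nonneg fun k _ => ?_) fun t ht => ?_
    · simpa using re_trace_mul_nonneg PosSemidef.one (posSemidef_conjTranspose_mul_self (Δ k))
    · have h1 := hmin (fun k => α k - (t : ℂ) • Δ k)
      rw [splitGram_sub_smul, ← hB, Matrix.add_mul, Matrix.sub_mul, Matrix.smul_mul,
        Matrix.smul_mul, Matrix.trace_add, Matrix.trace_sub, Matrix.trace_smul,
        Matrix.trace_smul, smul_eq_mul, smul_eq_mul, Complex.add_re, Complex.sub_re,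
        Complex.re_ofReal_mul, Complex.re_ofReal_mul] at h1
      have h2 : ((∑ k, ((α k * (Δ k)ᴴ + Δ k * (α k)ᴴ)
          - ((Δ k)ᴴ * (v k - α k) + (v k - α k)ᴴ * Δ k))) * E).trace.re
          = 2 * ∑ k, ((Δ k)ᴴ * Δ k).trace.re := by
        rw [Finset.sum_mul, Matrix.trace_sum, Complex.re_sum, Finset.mul_sum]
        refine Finset.sum_congr rfl fun k _ => ?_
        have e1 : (α k * (Δ k)ᴴ * E).trace = ((Δ k)ᴴ * (E * α k)).trace := by
          rw [Matrix.mul_assoc, Matrix.trace_mul_comm, Matrix.mul_assoc]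
        have e2 : (Δ k * (α k)ᴴ * E).trace.re = ((Δ k)ᴴ * (E * α k)).trace.re := by
          rw [← re_trace_conjTranspose, ← e1, Matrix.conjTranspose_mul, Matrix.conjTranspose_mul,
            Matrix.conjTranspose_conjTranspose, hEh, Matrix.trace_mul_comm]
        have e3 : ((Δ k)ᴴ * (v k - α k) * E).trace = ((Δ k)ᴴ * (β k * E)).trace := by
          rw [Matrix.mul_assoc]
        have e4 : ((v k - α k)ᴴ * Δ k * E).trace.re = ((Δ k)ᴴ * (β k * E)).trace.re := by
          rw [← re_trace_conjTranspose, ← e3, Matrix.conjTranspose_mul, Matrix.conjTranspose_mul,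
            Matrix.conjTranspose_conjTranspose, hEh, Matrix.trace_mul_comm]
        rw [Matrix.sub_mul, Matrix.add_mul, Matrix.add_mul, Matrix.trace_sub, Matrix.trace_add,
          Matrix.trace_add, Complex.sub_re, Complex.add_re, Complex.add_re, e1, e2, e3, e4]
        have e5 : ((Δ k)ᴴ * Δ k).trace.re
            = ((Δ k)ᴴ * (E * α k)).trace.re - ((Δ k)ᴴ * (β k * E)).trace.re := by
          rw [← Complex.sub_re, ← Matrix.trace_sub, ← Matrix.mul_sub]
        rw [e5]; ring
      rw [h2] at h1
      linarith
  have hEuler : ∀ k, E * α k = β k * E := by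
    intro k
    have h1 := (Finset.sum_eq_zero_iff_of_nonneg (fun k _ => by
      simpa using re_trace_mul_nonneg PosSemidef.one
        (posSemidef_conjTranspose_mul_self (Δ k)))).mp hΔ0 k (Finset.mem_univ k)
    have h2 : ((Δ k)ᴴ * Δ k).trace = 0 := by
      apply Complex.ext
      · simpa using h1
      · have := (posSemidef_conjTranspose_mul_self (Δ k)).trace_nonneg
        exact ((Complex.le_def.mp this).2).symm
    have h3 := Matrix.trace_conjTranspose_mul_self_eq_zero_iff.mp h2
    exact sub_eq_zero.mp h3
  have hDw : ∀ k, D * (E * α k) = α k := fun k => by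
    rw [← Matrix.mul_assoc, hDE, Matrix.one_mul]
  have hwD : ∀ k, E * α k * D = β k := fun k => by
    rw [hEuler, Matrix.mul_assoc, hED, Matrix.mul_one]
  have hgram : ∑ k, (E * α k) * (E * α k)ᴴ + ∑ k, (E * α k)ᴴ * (E * α k)
      + (δ : ℂ) • (E * E) = 1 := by
    have e1 : ∑ k, (E * α k)ᴴ * (E * α k) = ∑ k, (β k * E)ᴴ * (β k * E) :=
      Finset.sum_congr rfl fun k _ => by rw [hEuler]
    have e2 : E * B * E = 1 := by
      rw [← hDD, Matrix.mul_assoc, Matrix.mul_assoc, hDE, Matrix.mul_one, hED]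
    rw [e1, ← e2, hB, splitGram]
    simp only [Matrix.conjTranspose_mul, hEh, Matrix.mul_add, Matrix.add_mul, Finset.mul_sum,
      Finset.sum_mul, Matrix.mul_assoc, Matrix.mul_smul, Matrix.smul_mul, Matrix.one_mul]
    rfl
  have hEE : ((δ : ℂ) • (E * E)).PosSemidef := by
    have : (E * E).PosSemidef := by
      have := posSemidef_conjTranspose_mul_self E
      rwa [hEh] at this
    exact this.smul (by exact_mod_cast hδ.le)
  refine ⟨U, fun i => √(b i), fun k => E * α k, hU, hU', hs0, fun k => ?_, ?_, ?_, ?_⟩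
  · rw [← hD, hDw, hwD]; exact (add_sub_cancel _ _).symm
  · rw [← hgram, add_assoc, add_sub_cancel_left]
    exact (posSemidef_sum _ fun k _ => posSemidef_conjTranspose_mul_self _).add hEE
  · rw [← hgram, add_comm (∑ k, (E * α k) * (E * α k)ᴴ), add_assoc, add_sub_cancel_left]
    exact (posSemidef_sum _ fun k _ => posSemidef_self_mul_conjTranspose _).add hEE
  · have h1 : ∑ i, √(b i) = (D * 1).trace.re := by
      rw [Matrix.mul_one, hD, trace_conj_rdiag hU]; simp
    rw [h1, ← hgram, Matrix.mul_add, Matrix.mul_add, Matrix.mul_smul, ← Matrix.mul_assoc D E, hDE,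
      Matrix.one_mul, Matrix.trace_add, Matrix.trace_add, Matrix.trace_smul, Complex.add_re,
      Complex.add_re, smul_eq_mul, Complex.re_ofReal_mul, Finset.mul_sum, Finset.mul_sum,
      Matrix.trace_sum, Matrix.trace_sum, Complex.re_sum, Complex.re_sum,
      ← Finset.sum_add_distrib]
    have h2 : ∀ k, (D * ((E * α k) * (E * α k)ᴴ)).trace.re
        + (D * ((E * α k)ᴴ * (E * α k))).trace.re = ((E * α k)ᴴ * v k).trace.re := by
      intro k
      have hv : v k = D * (E * α k) + (E * α k) * D := by
        rw [hDw, hwD]; exact (add_sub_cancel _ _).symm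
      conv_rhs => rw [hv]
      generalize E * α k = w
      rw [Matrix.mul_add, Matrix.trace_add, Complex.add_re, ← Matrix.mul_assoc D w,
        Matrix.trace_mul_comm (D * w), Matrix.trace_mul_comm D, Matrix.mul_assoc wᴴ]
    rw [Finset.sum_congr rfl fun k _ => h2 k]
    have h3 : E.trace.re = ∑ i, 1 / √(b i) := by rw [hE, trace_conj_rdiag hU]; simp
    rw [h3]
    have h4 : ∑ i, 1 / √(b i) ≤ Fintype.card ι • (1 / √δ) := by
      rw [← Finset.card_univ]
      refine Finset.sum_le_card_nsmul _ _ _ fun i _ => ?_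
      have h5 := Real.sqrt_pos.mpr hδ
      have := hbδ i
      gcongr
    refine add_le_add le_rfl ?_
    calc δ * ∑ i, 1 / √(b i) ≤ δ * (Fintype.card ι • (1 / √δ)) := by gcongr
      _ = Fintype.card ι * √δ := by
        rw [nsmul_eq_mul]
        have h5 := Real.sqrt_pos.mpr hδ
        nth_rewrite 1 [← Real.mul_self_sqrt hδ.le]
        field_simp

/-- The case `p = 1` in dual form, with truncated test matrices. -/
lemma exists_sylvester_truncated {δ : ℝ} (hδ : 0 < δ) (v : Fin N → Matrix ι ι ℂ) :
    ∃ (U : Matrix ι ι ℂ) (d : ι → ℝ) (w : Fin N → Matrix ι ι ℂ)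
      (F : (Fin N → Bool) → Matrix ι ι ℂ),
      Uᴴ * U = 1 ∧ U * Uᴴ = 1 ∧ (∀ i, 0 < d i) ∧
      (∀ k, v k = (U * rdiag d * Uᴴ) * w k + w k * (U * rdiag d * Uᴴ)) ∧
      (1 - ∑ k, w k * (w k)ᴴ).PosSemidef ∧ (1 - ∑ k, (w k)ᴴ * w k).PosSemidef ∧
      (∀ ε, (((4 ^ 2 : ℝ) : ℂ) • (1 : Matrix ι ι ℂ) - (F ε)ᴴ * F ε).PosSemidef) ∧
      2 ^ N * ∑ i, d i ≤ 2 * ∑ ε, ((F ε)ᴴ * radSum v ε).trace.re + 2 ^ N * δ := by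
  set c : ℝ := Fintype.card ι + 1 with hc
  have hc0 : 0 < c := by positivity
  obtain ⟨U, d, w, hU, hU', hd, hv, h1, h2, htr⟩ :=
    exists_sylvester (δ := (δ / (2 * c)) ^ 2) (by positivity) v
  rw [Real.sqrt_sq (by positivity)] at htr
  set D := U * rdiag d * Uᴴ with hD
  have hDps : D.PosSemidef := posSemidef_conj_rdiag U fun i => (hd i).le
  have hDtr : D.trace.re = ∑ i, d i := by rw [hD, trace_conj_rdiag hU]; simp
  choose F hF hFle using fun ε => exists_truncation (R := 4) (by norm_num) hDps (radSum w ε)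
  refine ⟨U, d, w, F, hU, hU', hd, hv, h1, h2, hF, ?_⟩
  have hV : ∀ ε, D * radSum w ε + radSum w ε * D = radSum v ε := fun ε => by
    rw [mul_radSum, radSum_mul, ← radSum_add]
    exact congrArg (radSum · ε) (funext fun k => (hv k).symm)
  have h4 := sum_re_trace_mul_fourth_le hDps w h1 h2
  have h5 := sum_re_trace_mul_fourth_le hDps (fun k => (w k)ᴴ) (by simpa using h2)
    (by simpa using h1)
  simp only [← radSum_conjTranspose, Matrix.conjTranspose_conjTranspose] at h5
  have h6 : ∑ ε, ((radSum w ε)ᴴ * radSum v ε).trace.re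
      = 2 ^ N * ∑ k, ((w k)ᴴ * v k).trace.re := by
    have := congrArg (fun M : Matrix ι ι ℂ => M.trace.re)
      (sum_radSum_mul_radSum (fun k => (w k)ᴴ) v)
    simp only [← radSum_conjTranspose, Matrix.trace_sum, Matrix.trace_smul, Complex.re_sum] at this
    rw [this, Complex.re_nsmul, nsmul_eq_mul, ← Complex.re_sum, Nat.cast_pow, Nat.cast_ofNat]
  have h7 := Finset.sum_le_sum fun ε (_ : ε ∈ Finset.univ) => hFle ε
  simp only [hV] at h7
  rw [Finset.sum_add_distrib, ← Finset.mul_sum, Finset.sum_add_distrib, h6] at h7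
  have h8 : (Fintype.card ι : ℝ) * (δ / (2 * c)) ≤ δ / 2 := by
    rw [mul_div_assoc', div_le_div_iff₀ (by positivity) (by norm_num)]
    nlinarith
  have h9 : (2 : ℝ) ^ N * ∑ i, d i
      ≤ 2 ^ N * (∑ k, ((w k)ᴴ * v k).trace.re + δ / 2) := by
    gcongr; linarith
  rw [hDtr] at h4 h5
  have h0 : 0 ≤ (2 : ℝ) ^ N * ∑ i, d i :=
    mul_nonneg (by positivity) (Finset.sum_nonneg fun i _ => (hd i).le)
  nlinarith

end Sylvester

section Interpolation

lemma exists_integrableOn_min_le {p σ c : ℝ} (hp0 : 0 < p) (hp1 : p < 1) (hσ : 0 ≤ σ)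
    (hc : 0 < c) : ∃ h : ℝ → ℝ, IntegrableOn h (Set.Ioi 0) ∧
      ∫ u in Set.Ioi 0, h u = c ^ (1 - p) * σ ^ p / p ∧
      ∀ u, 0 < u → min σ (c * u ^ (-(1 / (1 - p)))) ≤ h u := by
  rcases hσ.eq_or_lt with rfl | hσ
  · exact ⟨fun _ => 0, integrableOn_zero, by simp [Real.zero_rpow hp0.ne'],
      fun u _ => min_le_left _ _⟩
  have hq : 0 < 1 - p := by linarith
  set ρ := 1 / (1 - p) with hρ
  set u₀ := (c / σ) ^ (1 - p) with hu₀
  have hu : 0 < u₀ := Real.rpow_pos_of_pos (by positivity) _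
  have hρ1 : -ρ < -1 := by
    rw [hρ, neg_lt_neg_iff, lt_div_iff₀ hq]; linarith
  have hi1 : IntegrableOn (fun _ : ℝ => σ) (Set.Ioc 0 u₀) :=
    integrableOn_const (by simp)
  have hi2 : IntegrableOn (fun u : ℝ => c * u ^ (-ρ)) (Set.Ioi u₀) :=
    (integrableOn_Ioi_rpow_of_lt hρ1 hu).const_mul c
  have hI1 := hi1.integrable_indicator measurableSet_Ioc
  have hI2 := hi2.integrable_indicator measurableSet_Ioi
  refine ⟨fun u => (Set.Ioc 0 u₀).indicator (fun _ => σ) u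
      + (Set.Ioi u₀).indicator (fun u => c * u ^ (-ρ)) u, (hI1.add hI2).integrableOn, ?_, ?_⟩
  · rw [integral_add hI1.integrableOn hI2.integrableOn,
      setIntegral_indicator measurableSet_Ioc, setIntegral_indicator measurableSet_Ioi]
    have e1 : Set.Ioi (0 : ℝ) ∩ Set.Ioc 0 u₀ = Set.Ioc 0 u₀ :=
      Set.inter_eq_right.mpr fun x hx => hx.1
    have e2 : Set.Ioi (0 : ℝ) ∩ Set.Ioi u₀ = Set.Ioi u₀ :=
      Set.inter_eq_right.mpr fun x hx => hu.trans hx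
    rw [e1, e2, integral_const_mul, integral_Ioi_rpow_of_lt hρ1 hu, setIntegral_const]
    have e3 : volume.real (Set.Ioc 0 u₀) = u₀ := by simp [hu.le]
    have e4 : u₀ ^ (-ρ + 1) = (c / σ) ^ (-p) := by
      rw [hu₀, ← Real.rpow_mul (by positivity)]
      congr 1; rw [hρ]; field_simp; ring
    rw [e3, e4, hu₀, smul_eq_mul, Real.div_rpow hc.le hσ.le, Real.div_rpow hc.le hσ.le,
      Real.rpow_sub hc, Real.rpow_sub hσ, Real.rpow_one, Real.rpow_one, Real.rpow_neg hc.le,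
      Real.rpow_neg hσ.le]
    have h1 : -ρ + 1 = -(p / (1 - p)) := by rw [hρ]; field_simp; ring
    rw [h1]
    have := Real.rpow_pos_of_pos hc p
    have := Real.rpow_pos_of_pos hσ p
    field_simp
    ring
  · intro u hu0
    dsimp only
    by_cases h : u ≤ u₀
    · rw [Set.indicator_of_mem (show u ∈ Set.Ioc 0 u₀ from ⟨hu0, h⟩),
        Set.indicator_of_notMem (by simpa using h), add_zero]
      exact min_le_left _ _
    · rw [Set.indicator_of_notMem (fun h' => h h'.2),
        Set.indicator_of_mem (show u ∈ Set.Ioi u₀ from not_le.mp h), zero_add]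
      exact min_le_right _ _

lemma integrableOn_rpow_mul_exp_neg {a m : ℝ} (ha : 0 < a) (hm : 0 < m) :
    IntegrableOn (fun u : ℝ => u ^ (a - 1) * Real.exp (-(m * u))) (Set.Ioi 0) := by
  refine Integrable.of_integral_ne_zero ?_
  rw [Real.integral_rpow_mul_exp_neg_mul_Ioi ha hm]
  have := Real.Gamma_pos_of_pos ha
  positivity

variable {ι : Type*} [Fintype ι]

lemma re_trace_conjTranspose_mul (F V : Matrix ι ι ℂ) :
    (Fᴴ * V).trace.re = ∑ i, ∑ j, (star (F i j) * V i j).re := by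
  rw [Finset.sum_comm]
  simp [Matrix.trace, Matrix.mul_apply, Complex.re_sum]

lemma re_trace_conjTranspose_mul_self (V : Matrix ι ι ℂ) :
    (Vᴴ * V).trace.re = ∑ i, ∑ j, Complex.normSq (V i j) := by
  rw [re_trace_conjTranspose_mul]
  refine Finset.sum_congr rfl fun i _ => Finset.sum_congr rfl fun j _ => ?_
  simp [Complex.normSq_apply]

variable [DecidableEq ι]

lemma rdiag_mul_mul_rdiag_apply (S : Matrix ι ι ℂ) (d e : ι → ℝ) (i j : ι) :
    (rdiag d * S * rdiag e) i j = ((d i * e j : ℝ) : ℂ) * S i j := by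
  rw [rdiag, rdiag, Matrix.mul_diagonal, Matrix.diagonal_mul]
  push_cast; ring

lemma one_sub_rdiag_mul_rdiag_posSemidef {d : ι → ℝ} (h0 : ∀ i, 0 ≤ d i) (h1 : ∀ i, d i ≤ 1) :
    (1 - rdiag d * rdiag d).PosSemidef := by
  rw [rdiag_mul, ← rdiag_one, rdiag, rdiag, Matrix.diagonal_sub, Matrix.posSemidef_diagonal_iff]
  intro i
  rw [← Complex.ofReal_sub, Complex.zero_le_real]
  nlinarith [h0 i, h1 i]

/-- Bound of the pairing of `(S_ij / (φ_i + γ_j))` with a bounded matrix, interpolating between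
the Schatten `p`-quasinorm of `S` and a weighted Hilbert-Schmidt norm. -/
lemma re_trace_conjTranspose_mul_div_le {p c : ℝ} (hp0 : 0 < p) (hp1 : p < 1) (hc : 0 < c)
    {S F : Matrix ι ι ℂ} {φ γ : ι → ℝ} (hφ : ∀ i, 0 < φ i) (hγ : ∀ j, 0 < γ j)
    (hF : (((4 ^ 2 : ℝ) : ℂ) • (1 : Matrix ι ι ℂ) - Fᴴ * F).PosSemidef) :
    (Fᴴ * Matrix.of fun i j => S i j / ((φ i + γ j : ℝ) : ℂ)).trace.re ≤
      4 * (c ^ (1 - p) / p * specSum (· ^ (p / 2)) (Sᴴ * S)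
        + c⁻¹ * Real.Gamma (1 / (1 - p) + 1) * ∑ i, ∑ j,
            Complex.normSq (S i j) * (1 / (2 * (φ i + γ j))) ^ (1 / (1 - p) + 1)) := by
  have hq : 0 < 1 - p := by linarith
  set ρ := 1 / (1 - p) with hρ
  have hρ0 : 0 < ρ := by positivity
  have hm : ∀ i j, 0 < φ i + γ j := fun i j => add_pos (hφ i) (hγ j)
  obtain ⟨U, s, hU, hU', hs⟩ := exists_eq_conj_rdiag (posSemidef_conjTranspose_mul_self S).1
  have hs0 := nonneg_of_posSemidef_conj hU hs (posSemidef_conjTranspose_mul_self S)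
  choose h hint hval hle using fun k =>
    exists_integrableOn_min_le hp0 hp1 (Real.sqrt_nonneg (s k)) hc
  -- pointwise estimate
  have key : ∀ u, 0 < u →
      ∑ i, ∑ j, (star (F i j) * S i j).re * Real.exp (-((φ i + γ j) * u)) ≤
        4 * (∑ k, h k u + c⁻¹ * ∑ i, ∑ j, Complex.normSq (S i j)
          * (u ^ (ρ + 1 - 1) * Real.exp (-(2 * (φ i + γ j) * u)))) := by
    intro u hu
    set τ := c * u ^ (-ρ) with hτ
    have hτ0 : 0 < τ := mul_pos hc (Real.rpow_pos_of_pos hu _)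
    set L := rdiag fun i => Real.exp (-(φ i * u)) with hL
    set R := rdiag fun i => Real.exp (-(γ i * u)) with hR
    have hLc : (1 - Lᴴ * L).PosSemidef := by
      rw [hL, rdiag_conjTranspose]
      exact one_sub_rdiag_mul_rdiag_posSemidef (fun i => (Real.exp_pos _).le) fun i =>
        Real.exp_le_one_iff.mpr (by have := hφ i; simp; positivity)
    have hRc : (1 - R * Rᴴ).PosSemidef := by
      rw [hR, rdiag_conjTranspose]
      exact one_sub_rdiag_mul_rdiag_posSemidef (fun i => (Real.exp_pos _).le) fun i =>
        Real.exp_le_one_iff.mpr (by have := hγ i; simp; positivity)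
    have happ : ∀ i j, (L * S * R) i j = (Real.exp (-((φ i + γ j) * u)) : ℂ) * S i j := by
      intro i j
      rw [hL, hR, rdiag_mul_mul_rdiag_apply, ← Real.exp_add]
      congr 3; ring
    clear_value L R
    set Z := L * S * R with hZ
    have h1 := re_trace_conjTranspose_mul_le (R := 4) (by norm_num) hF (V := Z)
    have h2 : specSum (fun t => √t) (Zᴴ * Z) ≤
        specSum (fun t => min (√t) τ) (Zᴴ * Z) + τ⁻¹ * (Zᴴ * Z).trace.re := by
      have hps := posSemidef_conjTranspose_mul_self Z
      rw [← specSum_id hps.1, ← specSum_const_mul, ← specSum_add]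
      refine specSum_mono hps fun t ht => ?_
      rcases le_total (√t) τ with h | h
      · rw [min_eq_left h]
        have : 0 ≤ τ⁻¹ * t := by positivity
        linarith
      · rw [min_eq_right h]
        have h3 : τ⁻¹ * t = √t * (√t / τ) := by
          rw [← mul_div_assoc, Real.mul_self_sqrt ht]; field_simp
        have h4 : 1 ≤ √t / τ := by rwa [one_le_div hτ0]
        have : √t * 1 ≤ √t * (√t / τ) := mul_le_mul_of_nonneg_left h4 (Real.sqrt_nonneg t)
        rw [h3]; linarith
    have h3 : specSum (fun t => min (√t) τ) (Zᴴ * Z) ≤ ∑ k, h k u := by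
      refine (specSum_min_sqrt_compress hLc hRc).trans ?_
      rw [hs, specSum_conj_rdiag _ hU]
      exact Finset.sum_le_sum fun k _ => hle k u hu
    have h4 : τ⁻¹ * (Zᴴ * Z).trace.re = c⁻¹ * ∑ i, ∑ j, Complex.normSq (S i j)
          * (u ^ (ρ + 1 - 1) * Real.exp (-(2 * (φ i + γ j) * u))) := by
      rw [re_trace_conjTranspose_mul_self, hτ, mul_inv, Real.rpow_neg hu.le, inv_inv, mul_assoc,
        Finset.mul_sum, add_sub_cancel_right]
      congr 1
      refine Finset.sum_congr rfl fun i _ => ?_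
      rw [Finset.mul_sum]
      refine Finset.sum_congr rfl fun j _ => ?_
      rw [happ, Complex.normSq_mul, Complex.normSq_ofReal, ← Real.exp_add]
      have : -((φ i + γ j) * u) + -((φ i + γ j) * u) = -(2 * (φ i + γ j) * u) := by ring
      rw [this]; ring
    have h5 : (Fᴴ * Z).trace.re
        = ∑ i, ∑ j, (star (F i j) * S i j).re * Real.exp (-((φ i + γ j) * u)) := by
      rw [re_trace_conjTranspose_mul]
      refine Finset.sum_congr rfl fun i _ => Finset.sum_congr rfl fun j _ => ?_
      rw [happ, mul_left_comm, Complex.re_ofReal_mul, mul_comm]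
    rw [← h5]
    linarith
  -- integration
  have hexp : ∀ {m : ℝ}, 0 < m → IntegrableOn (fun u : ℝ => Real.exp (-(m * u))) (Set.Ioi 0) ∧
      ∫ u in Set.Ioi 0, Real.exp (-(m * u)) = 1 / m := by
    intro m hm
    have h1 := integrableOn_rpow_mul_exp_neg one_pos hm
    have h2 := Real.integral_rpow_mul_exp_neg_mul_Ioi one_pos hm
    simp only [sub_self, Real.rpow_zero, one_mul, Real.rpow_one, Real.Gamma_one, mul_one]
      at h1 h2
    exact ⟨h1, h2⟩
  have hiL : ∀ i j, IntegrableOn (fun u : ℝ => (star (F i j) * S i j).re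
      * Real.exp (-((φ i + γ j) * u))) (Set.Ioi 0) :=
    fun i j => (hexp (hm i j)).1.const_mul _
  have hm2 : ∀ i j, 0 < 2 * (φ i + γ j) := fun i j => by have := hm i j; positivity
  have hiR : ∀ i j, IntegrableOn (fun u : ℝ => Complex.normSq (S i j)
      * (u ^ (ρ + 1 - 1) * Real.exp (-(2 * (φ i + γ j) * u)))) (Set.Ioi 0) :=
    fun i j => (integrableOn_rpow_mul_exp_neg (by linarith) (hm2 i j)).const_mul _
  have hL' : ∫ u in Set.Ioi 0,
      ∑ i, ∑ j, (star (F i j) * S i j).re * Real.exp (-((φ i + γ j) * u))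
      = (Fᴴ * Matrix.of fun i j => S i j / ((φ i + γ j : ℝ) : ℂ)).trace.re := by
    rw [re_trace_conjTranspose_mul, integral_finsetSum _ fun i _ =>
      integrable_finsetSum _ fun j _ => hiL i j]
    refine Finset.sum_congr rfl fun i _ => ?_
    rw [integral_finsetSum _ fun j _ => hiL i j]
    refine Finset.sum_congr rfl fun j _ => ?_
    rw [integral_const_mul, (hexp (hm i j)).2, Matrix.of_apply, mul_one_div,
      ← Complex.div_ofReal_re, mul_div_assoc]
  have hR' : ∫ u in Set.Ioi 0, 4 * (∑ k, h k u + c⁻¹ * ∑ i, ∑ j, Complex.normSq (S i j)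
          * (u ^ (ρ + 1 - 1) * Real.exp (-(2 * (φ i + γ j) * u))))
      = 4 * (c ^ (1 - p) / p * specSum (· ^ (p / 2)) (Sᴴ * S)
        + c⁻¹ * Real.Gamma (ρ + 1) * ∑ i, ∑ j,
            Complex.normSq (S i j) * (1 / (2 * (φ i + γ j))) ^ (ρ + 1)) := by
    rw [integral_const_mul, integral_add (integrable_finsetSum _ fun k _ => hint k)
      ((integrable_finsetSum _ fun i _ => integrable_finsetSum _ fun j _ => hiR i j).const_mul _),
      integral_const_mul, integral_finsetSum _ fun k _ => hint k,
      integral_finsetSum _ fun i _ => integrable_finsetSum _ fun j _ => hiR i j]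
    congr 2
    · rw [hs, specSum_conj_rdiag _ hU, Finset.mul_sum]
      refine Finset.sum_congr rfl fun k _ => ?_
      rw [hval, Real.sqrt_eq_rpow, ← Real.rpow_mul (hs0 k)]
      rw [one_div_mul_eq_div]; ring
    · rw [mul_assoc, Finset.mul_sum (a := Real.Gamma (ρ + 1))]
      congr 1
      refine Finset.sum_congr rfl fun i _ => ?_
      rw [integral_finsetSum _ fun j _ => hiR i j, Finset.mul_sum]
      refine Finset.sum_congr rfl fun j _ => ?_
      rw [integral_const_mul, Real.integral_rpow_mul_exp_neg_mul_Ioi (by linarith) (hm2 i j)]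
      ring
  rw [← hL', ← hR']
  refine setIntegral_mono_on (integrable_finsetSum _ fun i _ =>
    integrable_finsetSum _ fun j _ => hiL i j) (((integrable_finsetSum _ fun k _ => hint k).add
      ((integrable_finsetSum _ fun i _ =>
        integrable_finsetSum _ fun j _ => hiR i j).const_mul _)).const_mul _)
    measurableSet_Ioi fun u hu => key u hu

end Interpolation

section Holder

variable {ι : Type*} [Fintype ι] [DecidableEq ι] {N : ℕ}

/-- A form of Hölder's inequality for `Λ^r D`, where `r = 1 / p - 1`. -/
lemma specSum_rpow_rdiag_mul_mul_rdiag_le {p : ℝ} (hp0 : 0 < p) (hp1 : p < 1) {l d : ι → ℝ}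
    (hl : ∀ i, 0 < l i) (hd : ∀ i, 0 < d i) {U D : Matrix ι ι ℂ} (hU : Uᴴ * U = 1)
    (hU' : U * Uᴴ = 1) (hD : D = U * rdiag d * Uᴴ) :
    specSum (· ^ (p / 2)) (rdiag (fun i => l i ^ (1 / p - 1)) * (D * D)
      * rdiag (fun i => l i ^ (1 / p - 1))) ≤ 2 * ∑ i, d i + ∑ i, l i := by
  set Λ := rdiag (fun i => l i ^ (1 / p - 1)) with hΛ
  set Λ' := rdiag (fun i => (l i ^ (1 / p - 1))⁻¹) with hΛ'
  set D' := U * rdiag (fun i => (d i)⁻¹) * Uᴴ with hD'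
  have hl' : ∀ i, 0 < l i ^ (1 / p - 1) := fun i => Real.rpow_pos_of_pos (hl i) _
  have hΛΛ' : Λ * Λ' = 1 := by
    rw [hΛ, hΛ', rdiag_mul, ← rdiag_one]
    congr 1; funext i; exact mul_inv_cancel₀ (hl' i).ne'
  have hΛ'Λ : Λ' * Λ = 1 := by
    rw [hΛ, hΛ', rdiag_mul, ← rdiag_one]
    congr 1; funext i; exact inv_mul_cancel₀ (hl' i).ne'
  have hone : U * rdiag (fun _ => (1 : ℝ)) * Uᴴ = 1 := by
    rw [rdiag_one, Matrix.mul_one, hU']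
  have hDD' : D * D' = 1 := by
    rw [hD, hD', conj_rdiag_mul hU, ← hone]
    congr 3; funext i; exact mul_inv_cancel₀ (hd i).ne'
  have hΛh : Λᴴ = Λ := rdiag_conjTranspose _
  have hDh : Dᴴ = D := by rw [hD]; exact conj_rdiag_conjTranspose _ _
  have hDtr : D.trace.re = ∑ i, d i := by rw [hD, trace_conj_rdiag hU]; simp
  have hDps : D.PosSemidef := hD ▸ posSemidef_conj_rdiag U fun i => (hd i).le
  have hY : (Λ * D * Λ).PosSemidef := by
    have := hDps.mul_mul_conjTranspose_same Λ
    rwa [hΛh] at this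
  have hX : (Λ * (D * D) * Λ).PosSemidef := by
    have := posSemidef_self_mul_conjTranspose (Λ * D)
    rwa [Matrix.conjTranspose_mul, hΛh, hDh, Matrix.mul_assoc, ← Matrix.mul_assoc D,
      ← Matrix.mul_assoc] at this
  obtain ⟨V, f, hV, hV', hf⟩ := exists_eq_conj_rdiag hY.1
  have hinv : Λ * D * Λ * (Λ' * D' * Λ') = 1 := by
    calc Λ * D * Λ * (Λ' * D' * Λ') = Λ * (D * ((Λ * Λ') * D')) * Λ' := by
          simp only [Matrix.mul_assoc]
      _ = 1 := by rw [hΛΛ', Matrix.one_mul, hDD', Matrix.mul_one, hΛΛ']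
  have hf0 : ∀ i, 0 < f i := by
    have hu : IsUnit (Λ * D * Λ) := IsUnit.of_mul_eq_one _ hinv
    exact fun i => pos_of_posDef_conj hV hf (hY.posDef_iff_isUnit.mpr hu) i
  have hfinv : V * rdiag (fun i => (f i)⁻¹) * Vᴴ = Λ' * D' * Λ' := by
    have h1 : V * rdiag (fun i => (f i)⁻¹) * Vᴴ * (Λ * D * Λ) = 1 := by
      rw [hf, conj_rdiag_mul hV]
      have : (fun i => (f i)⁻¹ * f i) = fun _ => (1 : ℝ) := by
        funext i; exact inv_mul_cancel₀ (hf0 i).ne'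
      rw [this, rdiag_one, Matrix.mul_one, hV']
    exact left_inv_eq_right_inv h1 hinv
  have hs : 0 < 1 - p / 2 := by linarith
  have hsp : 0 < 2 - p := by linarith
  have hq : 0 < 1 - p := by linarith
  clear_value Λ Λ' D'
  have hb1 := specSum_rpow_le (s := p / 2) (by linarith) (by linarith) hX hV hV'
    (g := fun i => f i ^ (1 / (1 - p / 2))) fun i => Real.rpow_pos_of_pos (hf0 i) _
  have e1 : (fun j => (f j ^ (1 / (1 - p / 2))) ^ (p / 2 - 1)) = fun j => (f j)⁻¹ := by
    funext j
    rw [← Real.rpow_mul (hf0 j).le, ← Real.rpow_neg_one]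
    congr 1; field_simp; ring
  have e2 : (Λ * (D * D) * Λ * (Λ' * D' * Λ')).trace = D.trace := by
    calc (Λ * (D * D) * Λ * (Λ' * D' * Λ')).trace
        = (Λ * (D * (D * ((Λ * Λ') * D'))) * Λ').trace := by simp only [Matrix.mul_assoc]
      _ = D.trace := by
        rw [hΛΛ', Matrix.one_mul, hDD', Matrix.mul_one, Matrix.trace_mul_comm,
          ← Matrix.mul_assoc, hΛ'Λ, Matrix.one_mul]
  rw [e1, hfinv, e2, hDtr] at hb1
  have e3 : ∑ j, (f j ^ (1 / (1 - p / 2))) ^ (p / 2)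
      = specSum (· ^ (p / (2 - p))) (Λ * D * Λ) := by
    rw [hf, specSum_conj_rdiag _ hV]
    refine Finset.sum_congr rfl fun j _ => ?_
    rw [← Real.rpow_mul (hf0 j).le]
    congr 1; field_simp
  have hb2 := specSum_rpow_le (s := p / (2 - p)) (by positivity)
    (by rw [div_lt_one hsp]; linarith) hY (V := 1) (by simp) (by simp)
    (g := fun i => l i ^ ((2 - p) / p)) fun i => Real.rpow_pos_of_pos (hl i) _
  have e4 : rdiag (fun j => (l j ^ ((2 - p) / p)) ^ (p / (2 - p) - 1)) = Λ' * Λ' := by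
    rw [hΛ', rdiag_mul]
    congr 1; funext j
    rw [← Real.rpow_mul (hl j).le, ← mul_inv, ← Real.rpow_add (hl j), ← Real.rpow_neg (hl j).le]
    congr 1; field_simp; ring
  have e5 : (Λ * D * Λ * (Λ' * Λ')).trace = D.trace := by
    calc (Λ * D * Λ * (Λ' * Λ')).trace = (Λ * (D * (Λ * Λ')) * Λ').trace := by
          simp only [Matrix.mul_assoc]
      _ = D.trace := by
        rw [hΛΛ', Matrix.mul_one, Matrix.trace_mul_comm, ← Matrix.mul_assoc, hΛ'Λ,
          Matrix.one_mul]
  simp only [Matrix.one_mul, Matrix.conjTranspose_one, Matrix.mul_one] at hb2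
  rw [e4, e5, hDtr] at hb2
  have e6 : ∑ j, (l j ^ ((2 - p) / p)) ^ (p / (2 - p)) = ∑ j, l j := by
    refine Finset.sum_congr rfl fun j _ => ?_
    rw [← Real.rpow_mul (hl j).le]
    have : (2 - p) / p * (p / (2 - p)) = 1 := by field_simp
    rw [this, Real.rpow_one]
  rw [e6] at hb2
  rw [e3] at hb1
  linarith

lemma specSum_rpow_sum_mul_conjTranspose_le {s : ℝ} (hs0 : 0 < s) (hs1 : s < 1)
    (B : Fin N → Matrix ι ι ℂ) {g : ι → ℝ} (hg : ∀ i, 0 < g i) :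
    specSum (· ^ s) (∑ k, B k * (B k)ᴴ) ≤
      ∑ i, g i ^ s + ∑ k, ∑ i, ∑ j, g i ^ (s - 1) * Complex.normSq (B k i j) := by
  have hX : (∑ k, B k * (B k)ᴴ).PosSemidef :=
    posSemidef_sum _ fun k _ => posSemidef_self_mul_conjTranspose (B k)
  refine (specSum_rpow_le hs0 hs1 hX (V := 1) (by simp) (by simp) hg).trans_eq ?_
  rw [Matrix.one_mul, Matrix.conjTranspose_one, Matrix.mul_one, Matrix.trace_mul_comm,
    Finset.mul_sum, Matrix.trace_sum, Complex.re_sum]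
  congr 1
  refine Finset.sum_congr rfl fun k _ => ?_
  have := trace_rdiag_mul_mul_rdiag_mul (B k) (fun j => g j ^ (s - 1)) fun _ => 1
  rw [rdiag_one, Matrix.mul_one, Matrix.mul_assoc] at this
  simpa using this

lemma sum_sum_normSq_mul_le {w : Fin N → Matrix ι ι ℂ} {U : Matrix ι ι ℂ} (hU : Uᴴ * U = 1)
    (hw : (1 - ∑ k, (w k)ᴴ * w k).PosSemidef) {d : ι → ℝ} (hd : ∀ i, 0 ≤ d i) :
    ∑ k, ∑ i, ∑ j, d j * Complex.normSq ((w k * U) i j) ≤ ∑ j, d j := by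
  have h : ∀ j, ∑ k, ∑ i, Complex.normSq ((w k * U) i j) ≤ 1 := by
    intro j
    have h1 := (hw.conjTranspose_mul_mul_same U).diag_nonneg (i := j)
    rw [Matrix.mul_sub, Matrix.sub_mul, Matrix.mul_one, hU, Finset.mul_sum, Finset.sum_mul,
      Matrix.sub_apply, Matrix.one_apply_eq, Matrix.sum_apply, sub_nonneg] at h1
    have h2 : ∀ k, (Uᴴ * ((w k)ᴴ * w k) * U) j j
        = ((∑ i, Complex.normSq ((w k * U) i j) : ℝ) : ℂ) := by
      intro k
      have : Uᴴ * ((w k)ᴴ * w k) * U = (w k * U)ᴴ * (w k * U) := by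
        simp only [Matrix.conjTranspose_mul, Matrix.mul_assoc]
      rw [this, Matrix.mul_apply]
      push_cast
      refine Finset.sum_congr rfl fun i _ => ?_
      rw [Matrix.conjTranspose_apply, Complex.star_def, ← Complex.normSq_eq_conj_mul_self]
    rw [Finset.sum_congr rfl fun k _ => h2 k, ← Complex.ofReal_sum] at h1
    exact_mod_cast h1
  calc ∑ k, ∑ i, ∑ j, d j * Complex.normSq ((w k * U) i j)
      = ∑ j, d j * ∑ k, ∑ i, Complex.normSq ((w k * U) i j) := by
        simp only [Finset.mul_sum]
        rw [Finset.sum_comm]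
        rw [Finset.sum_congr rfl fun i _ => Finset.sum_comm, Finset.sum_comm]
        exact Finset.sum_congr rfl fun j _ => Finset.sum_comm
    _ ≤ ∑ j, d j := Finset.sum_le_sum fun j _ => mul_le_of_le_one_right (hd j) (h j)

/-- Splitting of `Λ^r w_k D` into a row part and a column part, where `r = 1 / p - 1`. -/
lemma exists_split_rdiag_mul_mul {p : ℝ} (hp0 : 0 < p) (hp1 : p < 1) {l d : ι → ℝ}
    (hl : ∀ i, 0 < l i) (hd : ∀ i, 0 < d i) {U : Matrix ι ι ℂ} (hU : Uᴴ * U = 1)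
    {w : Fin N → Matrix ι ι ℂ} (hw : (1 - ∑ k, (w k)ᴴ * w k).PosSemidef) :
    ∃ a b : Fin N → Matrix ι ι ℂ,
      (∀ k, rdiag (fun i => l i ^ (1 / p - 1)) * w k * (U * rdiag d * Uᴴ) = a k + b k) ∧
      specSum (· ^ (p / 2)) (∑ k, (a k)ᴴ * a k) ≤ 2 * ∑ i, d i ∧
      specSum (· ^ (p / 2)) (∑ k, b k * (b k)ᴴ) ≤ ∑ i, d i + ∑ i, l i := by
  set T : Fin N → Matrix ι ι ℂ :=
    fun k => rdiag (fun i => l i ^ (1 / p - 1)) * (w k * U) * rdiag d with hT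
  set A : Fin N → Matrix ι ι ℂ := fun k => Matrix.of fun i j =>
    if l i < d j then T k i j else 0 with hA
  set B : Fin N → Matrix ι ι ℂ := fun k => Matrix.of fun i j =>
    if l i < d j then 0 else T k i j with hB
  have hTn : ∀ k i j, Complex.normSq (T k i j)
      = l i ^ (2 / p - 2) * d j ^ 2 * Complex.normSq ((w k * U) i j) := by
    intro k i j
    rw [hT]
    simp only []
    rw [rdiag_mul_mul_rdiag_apply, Complex.normSq_mul, Complex.normSq_ofReal]
    have : l i ^ (2 / p - 2) = l i ^ (1 / p - 1) * l i ^ (1 / p - 1) := by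
      rw [← Real.rpow_add (hl i)]; congr 1; ring
    rw [this]; ring
  have hAB : ∀ k, A k + B k = T k := by
    intro k; ext i j
    simp only [hA, hB, Matrix.add_apply, Matrix.of_apply]
    split_ifs <;> simp
  have hpow : ∀ {t : ℝ}, 0 < t → (t ^ (2 / p)) ^ (p / 2) = t ∧
      (t ^ (2 / p)) ^ (p / 2 - 1) = t ^ (1 - 2 / p) := by
    intro t ht
    rw [← Real.rpow_mul ht.le, ← Real.rpow_mul ht.le]
    constructor
    · rw [show 2 / p * (p / 2) = 1 by field_simp, Real.rpow_one]
    · congr 1; field_simp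
  have hsum := sum_sum_normSq_mul_le hU hw fun i => (hd i).le
  have hr : 0 ≤ 2 / p - 2 := by
    rw [sub_nonneg, le_div_iff₀ hp0]; linarith
  refine ⟨fun k => A k * Uᴴ, fun k => B k * Uᴴ, fun k => ?_, ?_, ?_⟩
  · rw [← Matrix.add_mul, hAB, hT]; simp only [Matrix.mul_assoc]
  · have e : ∑ k, (A k * Uᴴ)ᴴ * (A k * Uᴴ) = U * (∑ k, (A k)ᴴ * ((A k)ᴴ)ᴴ) * Uᴴ := by
      rw [Finset.mul_sum, Finset.sum_mul]
      refine Finset.sum_congr rfl fun k _ => ?_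
      simp only [Matrix.conjTranspose_mul, Matrix.conjTranspose_conjTranspose, Matrix.mul_assoc]
    rw [e, specSum_conj _ hU]
    refine (specSum_rpow_sum_mul_conjTranspose_le (by linarith) (by linarith) (fun k => (A k)ᴴ)
      (g := fun i => d i ^ (2 / p)) fun i => Real.rpow_pos_of_pos (hd i) _).trans ?_
    have e1 : ∑ i, (d i ^ (2 / p)) ^ (p / 2) = ∑ i, d i :=
      Finset.sum_congr rfl fun i _ => (hpow (hd i)).1
    rw [e1, two_mul]
    refine add_le_add le_rfl (le_trans ?_ hsum)
    refine Finset.sum_le_sum fun k _ => ?_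
    rw [Finset.sum_comm]
    refine Finset.sum_le_sum fun i _ => Finset.sum_le_sum fun j _ => ?_
    rw [(hpow (hd j)).2, Matrix.conjTranspose_apply, Complex.star_def, Complex.normSq_conj]
    simp only [hA, Matrix.of_apply]
    split_ifs with h
    · rw [hTn, ← mul_assoc]
      refine mul_le_mul_of_nonneg_right ?_ (Complex.normSq_nonneg _)
      calc d j ^ (1 - 2 / p) * (l i ^ (2 / p - 2) * d j ^ 2)
          ≤ d j ^ (1 - 2 / p) * (d j ^ (2 / p - 2) * d j ^ 2) := by
            have := hd j
            have := Real.rpow_le_rpow (hl i).le h.le hr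
            gcongr
        _ = d j := by
            rw [← Real.rpow_natCast, ← Real.rpow_add (hd j), ← Real.rpow_add (hd j)]
            conv_rhs => rw [← Real.rpow_one (d j)]
            congr 1; push_cast; ring
    · simpa using mul_nonneg (hd j).le (Complex.normSq_nonneg _)
  · have e : ∑ k, (B k * Uᴴ) * (B k * Uᴴ)ᴴ = ∑ k, B k * (B k)ᴴ := by
      refine Finset.sum_congr rfl fun k _ => ?_
      rw [Matrix.conjTranspose_mul, Matrix.conjTranspose_conjTranspose, Matrix.mul_assoc,
        ← Matrix.mul_assoc Uᴴ, hU, Matrix.one_mul]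
    rw [e]
    refine (specSum_rpow_sum_mul_conjTranspose_le (by linarith) (by linarith) B
      (g := fun i => l i ^ (2 / p)) fun i => Real.rpow_pos_of_pos (hl i) _).trans ?_
    have e1 : ∑ i, (l i ^ (2 / p)) ^ (p / 2) = ∑ i, l i :=
      Finset.sum_congr rfl fun i _ => (hpow (hl i)).1
    rw [e1, add_comm]
    refine add_le_add (le_trans ?_ hsum) le_rfl
    refine Finset.sum_le_sum fun k _ => Finset.sum_le_sum fun i _ =>
      Finset.sum_le_sum fun j _ => ?_
    rw [(hpow (hl i)).2]
    simp only [hB, Matrix.of_apply]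
    split_ifs with h
    · simpa using mul_nonneg (hd j).le (Complex.normSq_nonneg _)
    · rw [hTn, ← mul_assoc]
      refine mul_le_mul_of_nonneg_right ?_ (Complex.normSq_nonneg _)
      have e2 : l i ^ (1 - 2 / p) * (l i ^ (2 / p - 2) * d j ^ 2) = d j * (d j / l i) := by
        rw [← mul_assoc, ← Real.rpow_add (hl i), show 1 - 2 / p + (2 / p - 2) = -1 by ring,
          Real.rpow_neg_one]
        ring
      rw [e2]
      refine mul_le_of_le_one_right (hd j).le ?_
      rw [div_le_one (hl i)]; exact not_lt.mp h

end Holder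

section Decomposition

variable {ι : Type*} [Fintype ι] [DecidableEq ι] {N : ℕ}

lemma specSum_rpow_sum_add_mul_conjTranspose_le {s : ℝ} (hs0 : 0 < s) (hs1 : s < 1)
    (x y : Fin N → Matrix ι ι ℂ) :
    specSum (· ^ s) (∑ k, (x k + y k) * (x k + y k)ᴴ) ≤
      2 * (specSum (· ^ s) (∑ k, x k * (x k)ᴴ) + specSum (· ^ s) (∑ k, y k * (y k)ᴴ)) := by
  have hps : ∀ z : Fin N → Matrix ι ι ℂ, (∑ k, z k * (z k)ᴴ).PosSemidef := fun z =>
    posSemidef_sum _ fun k _ => posSemidef_self_mul_conjTranspose (z k)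
  have h := hps fun k => x k - y k
  set X := ∑ k, x k * (x k)ᴴ with hX
  set Y := ∑ k, y k * (y k)ᴴ with hY
  have hXp : X.PosSemidef := hps x
  have hYp : Y.PosSemidef := hps y
  have e : ∑ k, (x k - y k) * (x k - y k)ᴴ
      = ((X + X) + (Y + Y)) - ∑ k, (x k + y k) * (x k + y k)ᴴ := by
    rw [hX, hY, eq_sub_iff_add_eq]
    simp only [← Finset.sum_add_distrib]
    refine Finset.sum_congr rfl fun k _ => ?_
    rw [Matrix.conjTranspose_add, Matrix.conjTranspose_sub]
    noncomm_ring
  rw [e] at h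
  refine (specSum_rpow_le_of_le hs0 hs1 (hps _) ((hXp.add hXp).add (hYp.add hYp)) h).trans ?_
  have h1 := specSum_rpow_add_le hs0 hs1 (hXp.add hXp) (hYp.add hYp)
  have h2 := specSum_rpow_add_le hs0 hs1 hXp hXp
  have h3 := specSum_rpow_add_le hs0 hs1 hYp hYp
  linarith

lemma exists_split_rdiag_mul_sylvester {p : ℝ} (hp0 : 0 < p) (hp1 : p < 1) {l d : ι → ℝ}
    (hl : ∀ i, 0 < l i) (hd : ∀ i, 0 < d i) {U D : Matrix ι ι ℂ} (hU : Uᴴ * U = 1)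
    (hU' : U * Uᴴ = 1) (hD : D = U * rdiag d * Uᴴ) {w : Fin N → Matrix ι ι ℂ}
    (hw : (1 - ∑ k, w k * (w k)ᴴ).PosSemidef) (hw' : (1 - ∑ k, (w k)ᴴ * w k).PosSemidef) :
    ∃ a b : Fin N → Matrix ι ι ℂ,
      (∀ k, rdiag (fun i => l i ^ (1 / p - 1)) * (D * w k + w k * D) = a k + b k) ∧
      specSum (· ^ (p / 2)) (∑ k, (a k)ᴴ * a k) ≤ 2 * ∑ i, d i ∧
      specSum (· ^ (p / 2)) (∑ k, b k * (b k)ᴴ) ≤ 6 * ∑ i, d i + 4 * ∑ i, l i := by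
  obtain ⟨a, b, hab, ha, hb⟩ := exists_split_rdiag_mul_mul hp0 hp1 hl hd hU hw'
  have hH := specSum_rpow_rdiag_mul_mul_rdiag_le hp0 hp1 hl hd hU hU' hD
  set Λ := rdiag (fun i => l i ^ (1 / p - 1)) with hΛ
  have hΛh : Λᴴ = Λ := rdiag_conjTranspose _
  have hDh : Dᴴ = D := by rw [hD]; exact conj_rdiag_conjTranspose _ _
  clear_value Λ
  refine ⟨a, fun k => Λ * D * w k + b k, fun k => ?_, ha, ?_⟩
  · rw [Matrix.mul_add, ← Matrix.mul_assoc, ← Matrix.mul_assoc, hD, hab]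
    beta_reduce
    abel
  · refine (specSum_rpow_sum_add_mul_conjTranspose_le (by linarith) (by linarith) _ _).trans ?_
    have e : ∑ k, Λ * D * w k * (Λ * D * w k)ᴴ
        = (Λ * D) * (∑ k, w k * (w k)ᴴ) * (Λ * D)ᴴ := by
      rw [Finset.mul_sum, Finset.sum_mul]
      refine Finset.sum_congr rfl fun k _ => ?_
      rw [Matrix.conjTranspose_mul _ (w k)]
      simp only [Matrix.mul_assoc]
    have e' : Λ * (D * D) * Λ = (Λ * D) * (Λ * D)ᴴ := by
      rw [Matrix.conjTranspose_mul, hΛh, hDh]; simp only [Matrix.mul_assoc]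
    have h1 : specSum (· ^ (p / 2)) (∑ k, Λ * D * w k * (Λ * D * w k)ᴴ)
        ≤ specSum (· ^ (p / 2)) (Λ * (D * D) * Λ) := by
      refine specSum_rpow_le_of_le (by linarith) (by linarith)
        (posSemidef_sum _ fun k _ => posSemidef_self_mul_conjTranspose _)
        (e' ▸ posSemidef_self_mul_conjTranspose _) ?_
      have := hw.mul_mul_conjTranspose_same (Λ * D)
      rwa [Matrix.mul_sub, Matrix.sub_mul, Matrix.mul_one, ← e, ← e'] at this
    linarith

lemma exists_split_sylvester {p : ℝ} (hp0 : 0 < p) (hp1 : p < 1) {l m d : ι → ℝ}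
    (hl : ∀ i, 0 < l i) (hm : ∀ i, 0 < m i) (hd : ∀ i, 0 < d i) {U D : Matrix ι ι ℂ}
    (hU : Uᴴ * U = 1) (hU' : U * Uᴴ = 1) (hD : D = U * rdiag d * Uᴴ)
    {w : Fin N → Matrix ι ι ℂ}
    (hw : (1 - ∑ k, w k * (w k)ᴴ).PosSemidef) (hw' : (1 - ∑ k, (w k)ᴴ * w k).PosSemidef) :
    ∃ a b : Fin N → Matrix ι ι ℂ,
      (∀ k, rdiag (fun i => l i ^ (1 / p - 1)) * (D * w k + w k * D)
        + (D * w k + w k * D) * rdiag (fun i => m i ^ (1 / p - 1)) = a k + b k) ∧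
      specSum (· ^ (p / 2)) (∑ k, (a k)ᴴ * a k) ≤ 16 * ∑ i, d i + 8 * ∑ i, m i ∧
      specSum (· ^ (p / 2)) (∑ k, b k * (b k)ᴴ) ≤ 16 * ∑ i, d i + 8 * ∑ i, l i := by
  obtain ⟨a, b, hab, ha, hb⟩ := exists_split_rdiag_mul_sylvester hp0 hp1 hl hd hU hU' hD hw hw'
  obtain ⟨a', b', hab', ha', hb'⟩ := exists_split_rdiag_mul_sylvester hp0 hp1 hm hd hU hU' hD
    (w := fun k => (w k)ᴴ) (by simpa using hw') (by simpa using hw)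
  have hDh : Dᴴ = D := by rw [hD]; exact conj_rdiag_conjTranspose _ _
  have hs0 : 0 < p / 2 := by linarith
  have hs1 : p / 2 < 1 := by linarith
  refine ⟨fun k => a k + (b' k)ᴴ, fun k => b k + (a' k)ᴴ, fun k => ?_, ?_, ?_⟩
  · have h := congrArg Matrix.conjTranspose (hab' k)
    simp only [Matrix.conjTranspose_add, Matrix.conjTranspose_mul, rdiag_conjTranspose, hDh,
      Matrix.conjTranspose_conjTranspose] at h
    rw [hab, add_comm (D * w k), h]
    beta_reduce
    abel
  · have h := specSum_rpow_sum_add_mul_conjTranspose_le hs0 hs1 (fun k => (a k)ᴴ) b'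
    simp only [Matrix.conjTranspose_add, Matrix.conjTranspose_conjTranspose] at h ⊢
    linarith
  · have h := specSum_rpow_sum_add_mul_conjTranspose_le hs0 hs1 b (fun k => (a' k)ᴴ)
    simp only [Matrix.conjTranspose_add, Matrix.conjTranspose_conjTranspose] at h ⊢
    linarith

end Decomposition

section Absorption

lemma sum_rpow_add_le {ι : Type*} [Fintype ι] {s δ : ℝ} (hs0 : 0 < s) (hs1 : s < 1) (hδ : 0 < δ) {ξ : ι → ℝ}
    (hξ : ∀ i, 0 ≤ ξ i) :
    ∑ i, (ξ i + δ) ^ s ≤ ∑ i, ξ i ^ s + Fintype.card ι * δ ^ s := by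
  calc ∑ i, (ξ i + δ) ^ s ≤ ∑ i, (ξ i ^ s + δ ^ s) :=
        Finset.sum_le_sum fun i _ => Real.rpow_add_le_add_rpow (hξ i) hδ.le hs0.le hs1.le
    _ = _ := by rw [Finset.sum_add_distrib]; simp

variable {ι : Type*} [Fintype ι] [DecidableEq ι] {N : ℕ}

lemma sum_normSq_radSum_apply {ι : Type*} (x : Fin N → Matrix ι ι ℂ) (i j : ι) :
    ∑ ε, Complex.normSq (radSum x ε i j) = 2 ^ N * ∑ k, Complex.normSq (x k i j) := by
  have h := sum_radSum_mul_radSum (fun k => star (x k i j)) fun k => x k i j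
  have e : ∀ ε, radSum (fun k => star (x k i j)) ε = star (radSum x ε i j) := by
    intro ε
    rw [← Matrix.conjTranspose_apply, radSum_conjTranspose, radSum_apply]
    rfl
  simp only [e] at h
  simp only [← radSum_apply, Complex.star_def, ← Complex.normSq_eq_conj_mul_self] at h
  rw [nsmul_eq_mul] at h
  exact_mod_cast h

lemma one_div_rpow_le_rpow_neg {p l φ y : ℝ} (hp0 : 0 < p) (hp1 : p < 1) (hl : 0 < l)
    (hφ : φ = l ^ (1 / p - 1)) (hy : φ ≤ y) :
    (1 / y) ^ (1 / (1 - p) + 1) ≤ l ^ (-((2 - p) / p)) := by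
  have hq : 0 < 1 - p := by linarith
  have hφ0 : 0 < φ := hφ ▸ Real.rpow_pos_of_pos hl _
  have h1 : (1 / y) ^ (1 / (1 - p) + 1) ≤ (1 / φ) ^ (1 / (1 - p) + 1) :=
    Real.rpow_le_rpow (by have := hφ0.trans_le hy; positivity)
      (one_div_le_one_div_of_le hφ0 hy) (by positivity)
  refine h1.trans_eq ?_
  rw [one_div, hφ, ← Real.rpow_neg hl.le, ← Real.rpow_mul hl.le]
  congr 1; field_simp; ring

lemma mul_rpow_neg_le {p κ δ ξ : ℝ} (hp0 : 0 < p) (hκ : 0 < κ) (hδ : 0 < δ) (hξ : 0 ≤ ξ) :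
    ξ * (κ * (ξ + δ) ^ (p / 2)) ^ (-((2 - p) / p))
      ≤ κ ^ (-((2 - p) / p)) * (ξ + δ) ^ (p / 2) := by
  have h0 : 0 < ξ + δ := by linarith
  rw [Real.mul_rpow hκ.le (Real.rpow_nonneg h0.le _), ← Real.rpow_mul h0.le, mul_left_comm]
  refine mul_le_mul_of_nonneg_left ?_ (Real.rpow_nonneg hκ.le _)
  calc ξ * (ξ + δ) ^ (p / 2 * -((2 - p) / p))
      ≤ (ξ + δ) ^ (1 : ℝ) * (ξ + δ) ^ (p / 2 * -((2 - p) / p)) := by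
        rw [Real.rpow_one]
        exact mul_le_mul_of_nonneg_right (by linarith) (Real.rpow_nonneg h0.le _)
    _ = (ξ + δ) ^ (p / 2) := by
        rw [← Real.rpow_add h0]; congr 1; field_simp; ring

/-- The absorption inequality, when the row and column Gram matrices are diagonal. -/
lemma exists_split_le_of_diagonal {p c κ δ : ℝ} (hp0 : 0 < p) (hp1 : p < 1) (hc : 0 < c)
    (hκ : 0 < κ) (hδ : 0 < δ) {x a b : Fin N → Matrix ι ι ℂ} (hx : ∀ k, x k = a k + b k)
    {ξ η : ι → ℝ} (hξ : ∑ k, b k * (b k)ᴴ = rdiag ξ) (hη : ∑ k, (a k)ᴴ * a k = rdiag η) :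
    ∃ a' b' : Fin N → Matrix ι ι ℂ, (∀ k, x k = a' k + b' k) ∧
      specSum (· ^ (p / 2)) (∑ k, (a' k)ᴴ * a' k)
          + specSum (· ^ (p / 2)) (∑ k, b' k * (b' k)ᴴ) ≤
        256 * (c ^ (1 - p) / p * ((∑ ε, specSum (· ^ (p / 2))
          ((radSum x ε)ᴴ * radSum x ε)) / 2 ^ N))
        + (512 * (c⁻¹ * Real.Gamma (1 / (1 - p) + 1) * κ ^ (-((2 - p) / p))) + 8 * κ)
          * (specSum (· ^ (p / 2)) (∑ k, (a k)ᴴ * a k)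
            + specSum (· ^ (p / 2)) (∑ k, b k * (b k)ᴴ)
            + 2 * (Fintype.card ι * δ ^ (p / 2)))
        + 32 * δ := by
  have hq : 0 < 1 - p := by linarith
  have hξ' : ∀ i, ξ i = ∑ k, ∑ j, Complex.normSq (b k i j) := by
    intro i
    have h := congrFun (congrFun hξ i) i
    rw [rdiag, Matrix.diagonal_apply_eq, Matrix.sum_apply] at h
    simp only [Matrix.mul_apply, Matrix.conjTranspose_apply, Complex.star_def,
      Complex.mul_conj] at h
    exact_mod_cast h.symm
  have hη' : ∀ j, η j = ∑ k, ∑ i, Complex.normSq (a k i j) := by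
    intro i
    have h := congrFun (congrFun hη i) i
    rw [rdiag, Matrix.diagonal_apply_eq, Matrix.sum_apply] at h
    simp only [Matrix.mul_apply, Matrix.conjTranspose_apply, Complex.star_def,
      ← Complex.normSq_eq_conj_mul_self] at h
    exact_mod_cast h.symm
  have hξ0 : ∀ i, 0 ≤ ξ i := fun i => hξ' i ▸
    Finset.sum_nonneg fun _ _ => Finset.sum_nonneg fun _ _ => Complex.normSq_nonneg _
  have hη0 : ∀ i, 0 ≤ η i := fun i => hη' i ▸
    Finset.sum_nonneg fun _ _ => Finset.sum_nonneg fun _ _ => Complex.normSq_nonneg _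
  set l : ι → ℝ := fun i => κ * (ξ i + δ) ^ (p / 2) with hl
  set m : ι → ℝ := fun i => κ * (η i + δ) ^ (p / 2) with hm
  have hl0 : ∀ i, 0 < l i := fun i =>
    mul_pos hκ (Real.rpow_pos_of_pos (by have := hξ0 i; linarith) _)
  have hm0 : ∀ i, 0 < m i := fun i =>
    mul_pos hκ (Real.rpow_pos_of_pos (by have := hη0 i; linarith) _)
  set φ : ι → ℝ := fun i => l i ^ (1 / p - 1) with hφ
  set γ : ι → ℝ := fun i => m i ^ (1 / p - 1) with hγ
  have hφ0 : ∀ i, 0 < φ i := fun i => Real.rpow_pos_of_pos (hl0 i) _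
  have hγ0 : ∀ i, 0 < γ i := fun i => Real.rpow_pos_of_pos (hm0 i) _
  set v : Fin N → Matrix ι ι ℂ := fun k => Matrix.of fun i j =>
    x k i j / ((φ i + γ j : ℝ) : ℂ) with hv
  have hxv : ∀ k, x k = rdiag φ * v k + v k * rdiag γ := by
    intro k; ext i j
    have h : ((φ i + γ j : ℝ) : ℂ) ≠ 0 :=
      Complex.ofReal_ne_zero.mpr (add_pos (hφ0 i) (hγ0 j)).ne'
    rw [Matrix.add_apply, rdiag, rdiag, Matrix.diagonal_mul, Matrix.mul_diagonal, hv]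
    simp only [Matrix.of_apply]
    rw [mul_comm (x k i j / _), ← add_mul, ← Complex.ofReal_add, mul_div_cancel₀ _ h]
  have hrv : ∀ ε, radSum v ε = Matrix.of fun i j =>
      radSum x ε i j / ((φ i + γ j : ℝ) : ℂ) := by
    intro ε; ext i j
    rw [radSum_apply, Matrix.of_apply, radSum_apply, radSum, radSum, Finset.sum_div]
    refine Finset.sum_congr rfl fun k _ => ?_
    rw [hv]; simp only [Matrix.of_apply, smul_eq_mul, mul_div_assoc]
  obtain ⟨U, d, w, F, hU, hU', hd, hvw, hw, hw', hF, hle⟩ := exists_sylvester_truncated hδ v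
  obtain ⟨a', b', hab, ha', hb'⟩ := exists_split_sylvester hp0 hp1 hl0 hm0 hd hU hU' rfl hw hw'
  refine ⟨a', b', fun k => by rw [← hab k, ← hvw k]; exact hxv k, ?_⟩
  set Q := ∑ ε, specSum (· ^ (p / 2)) ((radSum x ε)ᴴ * radSum x ε) with hQ
  set Γ := Real.Gamma (1 / (1 - p) + 1) with hΓ
  have hΓ0 : 0 < Γ := Real.Gamma_pos_of_pos (by positivity)
  set t := (2 - p) / p with ht
  have hweight : ∑ i, ∑ j, (∑ k, Complex.normSq (x k i j))
      * (1 / (2 * (φ i + γ j))) ^ (1 / (1 - p) + 1)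
      ≤ 2 * (κ ^ (-t) * (∑ i, (η i + δ) ^ (p / 2) + ∑ i, (ξ i + δ) ^ (p / 2))) := by
    have h1 : ∀ i j, (∑ k, Complex.normSq (x k i j))
        * (1 / (2 * (φ i + γ j))) ^ (1 / (1 - p) + 1)
        ≤ 2 * ((∑ k, Complex.normSq (a k i j)) * m j ^ (-t))
          + 2 * ((∑ k, Complex.normSq (b k i j)) * l i ^ (-t)) := by
      intro i j
      set z := (1 / (2 * (φ i + γ j))) ^ (1 / (1 - p) + 1) with hz
      have hi := hφ0 i
      have hj := hγ0 j
      have hz0 : 0 ≤ z := by positivity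
      have hzl : z ≤ l i ^ (-t) := one_div_rpow_le_rpow_neg hp0 hp1 (hl0 i) rfl (by linarith)
      have hzm : z ≤ m j ^ (-t) := one_div_rpow_le_rpow_neg hp0 hp1 (hm0 j) rfl (by linarith)
      have hn : ∑ k, Complex.normSq (x k i j)
          ≤ 2 * ∑ k, Complex.normSq (a k i j) + 2 * ∑ k, Complex.normSq (b k i j) := by
        rw [Finset.mul_sum, Finset.mul_sum, ← Finset.sum_add_distrib]
        refine Finset.sum_le_sum fun k _ => ?_
        rw [hx, Matrix.add_apply, Complex.normSq_apply, Complex.normSq_apply,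
          Complex.normSq_apply, Complex.add_re, Complex.add_im]
        nlinarith [sq_nonneg ((a k i j).re - (b k i j).re),
          sq_nonneg ((a k i j).im - (b k i j).im)]
      have ha0 : 0 ≤ ∑ k, Complex.normSq (a k i j) :=
        Finset.sum_nonneg fun _ _ => Complex.normSq_nonneg _
      have hb0 : 0 ≤ ∑ k, Complex.normSq (b k i j) :=
        Finset.sum_nonneg fun _ _ => Complex.normSq_nonneg _
      have h2 := mul_le_mul_of_nonneg_right hn hz0
      have h3 := mul_le_mul_of_nonneg_left hzm ha0
      have h4 := mul_le_mul_of_nonneg_left hzl hb0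
      linarith
    have h2 : ∑ i, ∑ j, (∑ k, Complex.normSq (a k i j)) * m j ^ (-t)
        ≤ κ ^ (-t) * ∑ j, (η j + δ) ^ (p / 2) := by
      rw [Finset.sum_comm, Finset.mul_sum]
      refine Finset.sum_le_sum fun j _ => ?_
      rw [← Finset.sum_mul, Finset.sum_comm, ← hη' j]
      exact mul_rpow_neg_le hp0 hκ hδ (hη0 j)
    have h3 : ∑ i, ∑ j, (∑ k, Complex.normSq (b k i j)) * l i ^ (-t)
        ≤ κ ^ (-t) * ∑ i, (ξ i + δ) ^ (p / 2) := by
      rw [Finset.mul_sum]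
      refine Finset.sum_le_sum fun i _ => ?_
      rw [← Finset.sum_mul, Finset.sum_comm, ← hξ' i]
      exact mul_rpow_neg_le hp0 hκ hδ (hξ0 i)
    refine (Finset.sum_le_sum fun i _ => Finset.sum_le_sum fun j _ => h1 i j).trans ?_
    simp only [Finset.sum_add_distrib, ← Finset.mul_sum]
    linarith
  have hpair : ∑ ε, ((F ε)ᴴ * radSum v ε).trace.re ≤
      4 * (c ^ (1 - p) / p * Q + c⁻¹ * Γ * (2 ^ N * ∑ i, ∑ j, (∑ k, Complex.normSq (x k i j))
      * (1 / (2 * (φ i + γ j))) ^ (1 / (1 - p) + 1))) := by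
    have h1 : ∀ ε, ((F ε)ᴴ * radSum v ε).trace.re ≤
        4 * (c ^ (1 - p) / p * specSum (· ^ (p / 2)) ((radSum x ε)ᴴ * radSum x ε)
          + c⁻¹ * Γ * ∑ i, ∑ j, Complex.normSq (radSum x ε i j)
            * (1 / (2 * (φ i + γ j))) ^ (1 / (1 - p) + 1)) := by
      intro ε
      rw [hrv]
      exact re_trace_conjTranspose_mul_div_le hp0 hp1 hc hφ0 hγ0 (hF ε)
    refine (Finset.sum_le_sum fun ε _ => h1 ε).trans_eq ?_
    rw [← Finset.mul_sum, Finset.sum_add_distrib, ← Finset.mul_sum, ← Finset.mul_sum]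
    congr 3
    rw [Finset.sum_comm (s := (Finset.univ : Finset (Fin N → Bool))), Finset.mul_sum]
    refine Finset.sum_congr rfl fun i _ => ?_
    rw [Finset.sum_comm (s := (Finset.univ : Finset (Fin N → Bool))), Finset.mul_sum]
    refine Finset.sum_congr rfl fun j _ => ?_
    rw [← Finset.sum_mul, sum_normSq_radSum_apply, mul_assoc]
  have h2N : (0 : ℝ) < 2 ^ N := by positivity
  have hξs : specSum (· ^ (p / 2)) (∑ k, b k * (b k)ᴴ) = ∑ i, ξ i ^ (p / 2) := by
    rw [hξ, specSum_rdiag]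
  have hηs : specSum (· ^ (p / 2)) (∑ k, (a k)ᴴ * a k) = ∑ i, η i ^ (p / 2) := by
    rw [hη, specSum_rdiag]
  have hξδ := sum_rpow_add_le (s := p / 2) (by linarith) (by linarith) hδ hξ0
  have hηδ := sum_rpow_add_le (s := p / 2) (by linarith) (by linarith) hδ hη0
  have hls : ∑ i, l i = κ * ∑ i, (ξ i + δ) ^ (p / 2) := by rw [hl, Finset.mul_sum]
  have hms : ∑ i, m i = κ * ∑ i, (η i + δ) ^ (p / 2) := by rw [hm, Finset.mul_sum]
  rw [hξs, hηs]
  rw [hls] at hb'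
  rw [hms] at ha'
  set Tξ := ∑ i, (ξ i + δ) ^ (p / 2)
  set Tη := ∑ i, (η i + δ) ^ (p / 2)
  set W := ∑ i, ∑ j, (∑ k, Complex.normSq (x k i j))
      * (1 / (2 * (φ i + γ j))) ^ (1 / (1 - p) + 1)
  have hd1 : ∑ i, d i ≤ 8 * (c ^ (1 - p) / p * (Q / 2 ^ N) + c⁻¹ * Γ * W) + δ := by
    have h := hle.trans (add_le_add (mul_le_mul_of_nonneg_left hpair zero_le_two) le_rfl)
    refine le_of_mul_le_mul_left (h.trans_eq ?_) h2N
    field_simp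
    ring
  have hcΓ : 0 < c⁻¹ * Γ := by positivity
  have hκt : 0 < κ ^ (-t) := Real.rpow_pos_of_pos hκ _
  have hd2 : c⁻¹ * Γ * W ≤ 2 * (c⁻¹ * Γ * κ ^ (-t)) * (Tη + Tξ) := by
    have := mul_le_mul_of_nonneg_left hweight hcΓ.le
    linarith
  have hTT : Tη + Tξ ≤ ∑ i, η i ^ (p / 2) + ∑ i, ξ i ^ (p / 2)
      + 2 * (Fintype.card ι * δ ^ (p / 2)) := by linarith
  have hfin := mul_le_mul_of_nonneg_left hTT
    (show 0 ≤ 512 * (c⁻¹ * Γ * κ ^ (-t)) + 8 * κ by positivity)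
  linarith

end Absorption

section Undiagonalize

variable {ι : Type*} [Fintype ι] [DecidableEq ι] {N : ℕ}

lemma sum_conj_mul_conjTranspose {U V : Matrix ι ι ℂ} (hV : V * Vᴴ = 1)
    (b : Fin N → Matrix ι ι ℂ) :
    ∑ k, (U * b k * V) * (U * b k * V)ᴴ = U * (∑ k, b k * (b k)ᴴ) * Uᴴ := by
  rw [Finset.mul_sum, Finset.sum_mul]
  refine Finset.sum_congr rfl fun k _ => ?_
  calc (U * b k * V) * (U * b k * V)ᴴ = U * (b k * (V * Vᴴ) * (b k)ᴴ) * Uᴴ := by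
        simp only [Matrix.conjTranspose_mul, Matrix.mul_assoc]
    _ = U * (b k * (b k)ᴴ) * Uᴴ := by rw [hV, Matrix.mul_one]

lemma sum_conj_conjTranspose_mul {U V : Matrix ι ι ℂ} (hU : Uᴴ * U = 1)
    (a : Fin N → Matrix ι ι ℂ) :
    ∑ k, (U * a k * V)ᴴ * (U * a k * V) = Vᴴ * (∑ k, (a k)ᴴ * a k) * V := by
  rw [Finset.mul_sum, Finset.sum_mul]
  refine Finset.sum_congr rfl fun k _ => ?_
  calc (U * a k * V)ᴴ * (U * a k * V) = Vᴴ * ((a k)ᴴ * ((Uᴴ * U) * a k)) * V := by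
        simp only [Matrix.conjTranspose_mul, Matrix.mul_assoc]
    _ = Vᴴ * ((a k)ᴴ * a k) * V := by rw [hU, Matrix.one_mul]

/-- The absorption inequality. -/
lemma exists_split_le {p c κ δ : ℝ} (hp0 : 0 < p) (hp1 : p < 1) (hc : 0 < c)
    (hκ : 0 < κ) (hδ : 0 < δ) {x a b : Fin N → Matrix ι ι ℂ} (hx : ∀ k, x k = a k + b k) :
    ∃ a' b' : Fin N → Matrix ι ι ℂ, (∀ k, x k = a' k + b' k) ∧
      specSum (· ^ (p / 2)) (∑ k, (a' k)ᴴ * a' k)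
          + specSum (· ^ (p / 2)) (∑ k, b' k * (b' k)ᴴ) ≤
        256 * (c ^ (1 - p) / p * ((∑ ε, specSum (· ^ (p / 2))
          ((radSum x ε)ᴴ * radSum x ε)) / 2 ^ N))
        + (512 * (c⁻¹ * Real.Gamma (1 / (1 - p) + 1) * κ ^ (-((2 - p) / p))) + 8 * κ)
          * (specSum (· ^ (p / 2)) (∑ k, (a k)ᴴ * a k)
            + specSum (· ^ (p / 2)) (∑ k, b k * (b k)ᴴ)
            + 2 * (Fintype.card ι * δ ^ (p / 2)))
        + 32 * δ := by
  obtain ⟨U, ξ, hU, hU', hξ⟩ := exists_eq_conj_rdiag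
    (posSemidef_sum Finset.univ fun k _ => posSemidef_self_mul_conjTranspose (b k)).1
  obtain ⟨V, η, hV, hV', hη⟩ := exists_eq_conj_rdiag
    (posSemidef_sum Finset.univ fun k _ => posSemidef_conjTranspose_mul_self (a k)).1
  have hUh : Uᴴᴴ = U := Matrix.conjTranspose_conjTranspose U
  have hVh : Vᴴᴴ = V := Matrix.conjTranspose_conjTranspose V
  have hξ' : ∑ k, (Uᴴ * b k * V) * (Uᴴ * b k * V)ᴴ = rdiag ξ := by
    rw [sum_conj_mul_conjTranspose hV', hUh, conj_conj_rdiag hU hξ]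
  have hη' : ∑ k, (Uᴴ * a k * V)ᴴ * (Uᴴ * a k * V) = rdiag η := by
    rw [sum_conj_conjTranspose_mul (by rw [hUh, hU']), conj_conj_rdiag hV hη]
  obtain ⟨a', b', hab, hle⟩ := exists_split_le_of_diagonal hp0 hp1 hc hκ hδ
    (x := fun k => Uᴴ * x k * V) (a := fun k => Uᴴ * a k * V) (b := fun k => Uᴴ * b k * V)
    (fun k => by rw [hx, Matrix.mul_add, Matrix.add_mul]) hξ' hη'
  have hrad : ∀ ε, radSum (fun k => Uᴴ * x k * V) ε = Uᴴ * radSum x ε * V := fun ε => by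
    rw [mul_radSum, radSum_mul]
  have hrad' : ∀ ε, specSum (· ^ (p / 2))
      ((radSum (fun k => Uᴴ * x k * V) ε)ᴴ * radSum (fun k => Uᴴ * x k * V) ε)
      = specSum (· ^ (p / 2)) ((radSum x ε)ᴴ * radSum x ε) := by
    intro ε
    have e : (Uᴴ * radSum x ε * V)ᴴ * (Uᴴ * radSum x ε * V)
        = Vᴴ * ((radSum x ε)ᴴ * radSum x ε) * Vᴴᴴ := by
      have := sum_conj_conjTranspose_mul (N := 1) (U := Uᴴ) (V := V) (by rw [hUh, hU'])
        fun _ => radSum x ε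
      simpa using this
    rw [hrad, e, specSum_conj _ (by rw [hVh, hV'])]
  have ea : specSum (· ^ (p / 2)) (∑ k, (a k)ᴴ * a k)
      = specSum (· ^ (p / 2)) (∑ k, (Uᴴ * a k * V)ᴴ * (Uᴴ * a k * V)) := by
    rw [hη', hη, specSum_conj _ hV]
  have eb : specSum (· ^ (p / 2)) (∑ k, b k * (b k)ᴴ)
      = specSum (· ^ (p / 2)) (∑ k, (Uᴴ * b k * V) * (Uᴴ * b k * V)ᴴ) := by
    rw [hξ', hξ, specSum_conj _ hU]
  refine ⟨fun k => U * a' k * Vᴴ, fun k => U * b' k * Vᴴ, fun k => ?_, ?_⟩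
  · rw [← Matrix.add_mul, ← Matrix.mul_add, ← hab k]
    calc x k = (U * Uᴴ) * x k * (V * Vᴴ) := by rw [hU', hV', Matrix.one_mul, Matrix.mul_one]
      _ = U * (Uᴴ * x k * V) * Vᴴ := by simp only [Matrix.mul_assoc]
  · rw [sum_conj_conjTranspose_mul hU, sum_conj_mul_conjTranspose (by rw [hVh, hV]), hVh]
    have e1 := specSum_conj (· ^ (p / 2)) hV (∑ k, (a' k)ᴴ * a' k)
    have e2 := specSum_conj (· ^ (p / 2)) hU (∑ k, b' k * (b' k)ᴴ)
    rw [e1, e2, ea, eb]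
    simpa only [hrad'] using hle

end Undiagonalize

section Schatten

variable {ι : Type*} [Fintype ι] [DecidableEq ι]

lemma exists_posPow_eq {A : Matrix ι ι ℂ} (hA : A.IsHermitian) :
    ∃ (U : Matrix ι ι ℂ) (d : ι → ℝ), Uᴴ * U = 1 ∧ A = U * rdiag d * Uᴴ ∧
      ∀ β, posPow A β = U * rdiag (fun i => d i ^ β) * Uᴴ := by
  refine ⟨hA.eigenvectorUnitary, hA.eigenvalues, Unitary.coe_star_mul_self _, ?_, fun β => ?_⟩
  · conv_lhs => rw [hA.spectral_theorem, Unitary.conjStarAlgAut_apply]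
    rfl
  · rw [posPow, dif_pos hA, Matrix.IsHermitian.cfc, Unitary.conjStarAlgAut_apply]
    rfl

lemma schattenNorm_eq (p : ℝ) (A : Matrix ι ι ℂ) :
    schattenNorm p A = specSum (· ^ (p / 2)) (Aᴴ * A) ^ (1 / p) := by
  obtain ⟨U, d, hU, hd, h⟩ := exists_posPow_eq (posSemidef_conjTranspose_mul_self A).1
  rw [schattenNorm, h, trace_conj_rdiag hU, hd, specSum_conj_rdiag _ hU, ← Complex.ofReal_sum,
    Complex.ofReal_re]

lemma schattenNorm_posPow_half {p : ℝ} {A : Matrix ι ι ℂ} (hA : A.PosSemidef) :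
    schattenNorm p (posPow A (1 / 2)) = specSum (· ^ (p / 2)) A ^ (1 / p) := by
  obtain ⟨U, d, hU, hd, h⟩ := exists_posPow_eq hA.1
  have hd0 := nonneg_of_posSemidef_conj hU hd hA
  rw [schattenNorm_eq, h, conj_rdiag_conjTranspose, conj_rdiag_mul hU, hd]
  congr 4
  congr 2
  funext i
  rw [← Real.sqrt_eq_rpow, Real.mul_self_sqrt (hd0 i)]

lemma specSum_rpow_nonneg {s : ℝ} {A : Matrix ι ι ℂ} (hA : A.PosSemidef) :
    0 ≤ specSum (· ^ s) A :=
  specSum_nonneg hA fun _ ht => Real.rpow_nonneg ht _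

lemma radAvg_eq {n N : ℕ} {p : ℝ} (hp : 0 < p) (x : Fin N → Matrix (Fin n) (Fin n) ℂ) :
    radAvg p x = (∑ ε, specSum (· ^ (p / 2)) ((radSum x ε)ᴴ * radSum x ε)) / 2 ^ N := by
  rw [radAvg, one_div_mul_eq_div]
  congr 1
  refine Finset.sum_congr rfl fun ε _ => ?_
  rw [schattenNorm_eq, ← Real.rpow_mul (specSum_rpow_nonneg
    (posSemidef_conjTranspose_mul_self _)), one_div_mul_cancel hp.ne', Real.rpow_one]
  rfl

lemma tripleNorm_le {n N : ℕ} {p : ℝ} (hp : 0 < p) {x a b : Fin N → Matrix (Fin n) (Fin n) ℂ}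
    (hx : ∀ k, x k = a k + b k) :
    tripleNorm p x ≤ 2 * (specSum (· ^ (p / 2)) (∑ k, (a k)ᴴ * a k)
      + specSum (· ^ (p / 2)) (∑ k, b k * (b k)ᴴ)) ^ (1 / p) := by
  have hA : (∑ k, (a k)ᴴ * a k).PosSemidef :=
    posSemidef_sum _ fun k _ => posSemidef_conjTranspose_mul_self _
  have hB : (∑ k, b k * (b k)ᴴ).PosSemidef :=
    posSemidef_sum _ fun k _ => posSemidef_self_mul_conjTranspose _
  have hA0 := specSum_rpow_nonneg (s := p / 2) hA
  have hB0 := specSum_rpow_nonneg (s := p / 2) hB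
  have hp' : 0 ≤ 1 / p := by positivity
  have h : tripleNorm p x ≤ schattenNorm p (posPow (∑ k, (a k)ᴴ * a k) (1/2))
      + schattenNorm p (posPow (∑ k, b k * (b k)ᴴ) (1/2)) := by
    refine csInf_le ⟨0, ?_⟩ ⟨a, b, hx, rfl⟩
    rintro r ⟨a, b, -, rfl⟩
    rw [schattenNorm_eq, schattenNorm_eq]
    exact add_nonneg
      (Real.rpow_nonneg (specSum_rpow_nonneg (posSemidef_conjTranspose_mul_self _)) _)
      (Real.rpow_nonneg (specSum_rpow_nonneg (posSemidef_conjTranspose_mul_self _)) _)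
  rw [schattenNorm_posPow_half hA, schattenNorm_posPow_half hB] at h
  have h1 := Real.rpow_le_rpow hA0 (le_add_of_nonneg_right hB0) hp'
  have h2 := Real.rpow_le_rpow hB0 (le_add_of_nonneg_left hA0) hp'
  linarith

end Schatten

/-- Non-commutative Khintchine inequality for `0 < q < 1`, Schatten-class version. -/
theorem statement0 (q : ℝ) (hq0 : 0 < q) (hq1 : q < 1) :
    ∃ β : ℝ, 0 < β ∧ ∀ (n N : ℕ), 1 ≤ n → 1 ≤ N →
      ∀ x : Fin N → Matrix (Fin n) (Fin n) ℂ,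
        tripleNorm q x ≤ β * (radAvg q x) ^ (1 / q) := by
  have hq : 0 < 1 - q := by linarith
  set κ : ℝ := 1 / 32 with hκ
  set B := Real.Gamma (1 / (1 - q) + 1) * κ ^ (-((2 - q) / q)) with hB
  have hB0 : 0 < B :=
    mul_pos (Real.Gamma_pos_of_pos (by positivity)) (Real.rpow_pos_of_pos (by norm_num) _)
  set c := 2048 * B with hc
  have hc0 : 0 < c := by positivity
  set C := 256 * (c ^ (1 - q) / q) with hC
  have hC0 : 0 < C := by positivity
  have hcoef : 512 * (c⁻¹ * Real.Gamma (1 / (1 - q) + 1) * κ ^ (-((2 - q) / q))) + 8 * κ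
      = 1 / 2 := by
    rw [mul_assoc c⁻¹, ← hB, hc, hκ]
    field_simp
    norm_num
  refine ⟨2 * (2 * C) ^ (1 / q), by positivity, fun n N _ _ x => ?_⟩
  set P := radAvg q x with hP
  have hP' := radAvg_eq hq0 x
  have hP0 : 0 ≤ P := by
    rw [hP, hP']
    exact div_nonneg (Finset.sum_nonneg fun ε _ => specSum_rpow_nonneg
      (posSemidef_conjTranspose_mul_self _)) (by positivity)
  set E : Set ℝ := {r | ∃ a b : Fin N → Matrix (Fin n) (Fin n) ℂ, (∀ k, x k = a k + b k) ∧
    r = specSum (· ^ (q / 2)) (∑ k, (a k)ᴴ * a k)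
      + specSum (· ^ (q / 2)) (∑ k, b k * (b k)ᴴ)} with hE
  have hE0 : ∀ r ∈ E, 0 ≤ r := by
    rintro r ⟨a, b, -, rfl⟩
    exact add_nonneg
      (specSum_rpow_nonneg (posSemidef_sum _ fun k _ => posSemidef_conjTranspose_mul_self _))
      (specSum_rpow_nonneg (posSemidef_sum _ fun k _ => posSemidef_self_mul_conjTranspose _))
  have hEne : E.Nonempty := ⟨_, x, 0, fun k => by simp, rfl⟩
  have hEbdd : BddBelow E := ⟨0, hE0⟩
  have hstep : ∀ r ∈ E, sInf E ≤ C * P + 1 / 2 * r := by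
    rintro r ⟨a, b, hx, rfl⟩
    set r := specSum (· ^ (q / 2)) (∑ k, (a k)ᴴ * a k)
      + specSum (· ^ (q / 2)) (∑ k, b k * (b k)ᴴ) with hr
    have h1 : ∀ δ : ℝ, 0 < δ →
        sInf E ≤ C * P + 1 / 2 * (r + 2 * (n * δ ^ (q / 2))) + 32 * δ := by
      intro δ hδ
      obtain ⟨a', b', hx', hle⟩ := exists_split_le hq0 hq1 hc0 (κ := κ) (by norm_num) hδ hx
      refine (csInf_le hEbdd ⟨a', b', hx', rfl⟩).trans (hle.trans_eq ?_)
      rw [hcoef, ← hP', ← hr, Fintype.card_fin, hC, mul_assoc 256]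
    have h2 : Filter.Tendsto
        (fun δ : ℝ => C * P + 1 / 2 * (r + 2 * (n * δ ^ (q / 2))) + 32 * δ)
        (nhdsWithin 0 (Set.Ioi 0)) (nhds (C * P + 1 / 2 * r)) := by
      have h3 : Continuous
          fun δ : ℝ => C * P + 1 / 2 * (r + 2 * (n * δ ^ (q / 2))) + 32 * δ := by
        have := Real.continuous_rpow_const (q := q / 2) (by positivity)
        fun_prop
      have h4 := h3.tendsto 0
      simp only [Real.zero_rpow (by positivity : q / 2 ≠ 0), mul_zero, add_zero] at h4
      exact h4.mono_left nhdsWithin_le_nhds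
    exact ge_of_tendsto h2 (Filter.eventually_of_mem self_mem_nhdsWithin h1)
  have hinf : sInf E ≤ 2 * C * P := by
    have : 2 * (sInf E - C * P) ≤ sInf E :=
      le_csInf hEne fun r hr => by have := hstep r hr; linarith
    linarith
  rcases le_or_gt (tripleNorm q x) 0 with ht | ht
  · exact ht.trans (by positivity)
  have hlow : (tripleNorm q x / 2) ^ q ≤ sInf E := by
    refine le_csInf hEne ?_
    rintro r ⟨a, b, hx, rfl⟩
    have h0 := hE0 _ ⟨a, b, hx, rfl⟩
    have h1 : tripleNorm q x / 2 ≤ _ := (div_le_iff₀' two_pos).mpr (tripleNorm_le hq0 hx)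
    refine (Real.rpow_le_rpow (by positivity) h1 hq0.le).trans_eq ?_
    rw [← Real.rpow_mul h0, one_div_mul_cancel hq0.ne', Real.rpow_one]
  have h := Real.rpow_le_rpow (by positivity) (hlow.trans hinf)
    (show 0 ≤ 1 / q by positivity)
  rw [← Real.rpow_mul (by positivity), mul_one_div_cancel hq0.ne', Real.rpow_one,
    Real.mul_rpow (by positivity) hP0] at h
  linarith
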